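/- Let n ≥ 1 and let m be a positive integer. Then, as an identity of rational functions in ℚ(x_1,…,x_n), the Schur polynomial s_{(m^n)} in the 2n variables (x_1, x_1^{−1}, …, x_n, x_n^{−1}) equals the sum of the symplectic characters sp_λ(x_1,…,x_n) over all λ ∈ Even′((m^n)) if n is even, and over all λ ∈ Odd′((m^n)) if n is odd. -/

import Mathlib

open Matrix BigOperators
open scoped Classical

noncomputable section

/-- The field `ℚ(t_1, …, t_n)` of rational functions in `n` indeterminates over `ℚ`. -/
abbrev FF (n : ℕ) : Type := FractionRing (MvPolynomial (Fin n) ℚ)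

/-- The `i`-th indeterminate, viewed as an element of `FF n`. -/
def gen (n : ℕ) (i : Fin n) : FF n :=
  algebraMap (MvPolynomial (Fin n) ℚ) (FF n) (MvPolynomial.X i)

variable {F : Type*} [Field F]

/-- Symplectic character `sp_λ(z_1, …, z_N)` for an integer weight `μ`. -/
def spP {N : ℕ} (z : Fin N → F) (μ : Fin N → ℤ) : F :=
  Matrix.det (Matrix.of fun i j : Fin N =>
      z j ^ (μ i + (N : ℤ) - (i : ℕ)) - z j ^ (-(μ i + (N : ℤ) - (i : ℕ)))) /
  Matrix.det (Matrix.of fun i j : Fin N =>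
      z j ^ ((N : ℤ) - (i : ℕ)) - z j ^ (-((N : ℤ) - (i : ℕ))))

/-- The matrix `Ā_λ` of the bialternant formula for the intermediate symplectic character
`sp^{(k, N-k)}` with integer weight `μ`. -/
def interMatP {N : ℕ} (k : ℕ) (z : Fin N → F) (μ : Fin N → ℤ) : Matrix (Fin N) (Fin N) F :=
  Matrix.of fun i j : Fin N =>
    if (j : ℕ) < k then
      z j ^ (μ i + (k : ℤ) - (i : ℕ)) /
          ∏ l ∈ Finset.univ.filter (fun l : Fin N => k ≤ (l : ℕ)), (1 - (z j)⁻¹ * z l) -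
        z j ^ (-(μ i + (k : ℤ) - (i : ℕ))) /
          ∏ l ∈ Finset.univ.filter (fun l : Fin N => k ≤ (l : ℕ)), (1 - z j * z l)
    else z j ^ (μ i + (N : ℤ) - 1 - (i : ℕ))

/-- Intermediate symplectic character `sp^{(k, N-k)}_μ(z_1, …, z_k | z_{k+1}, …, z_N)`
for an integer weight `μ`. -/
def spInterP {N : ℕ} (k : ℕ) (z : Fin N → F) (μ : Fin N → ℤ) : F :=
  (interMatP k z μ).det / (interMatP k z fun _ => 0).det

/-- Schur function `s_μ(z_1, …, z_N)` as a ratio of alternants (bialternant formula). -/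
def schurP {N : ℕ} (z : Fin N → F) (μ : Fin N → ℤ) : F :=
  Matrix.det (Matrix.of fun i j : Fin N => z j ^ (μ i + (N : ℤ) - 1 - (i : ℕ))) /
  Matrix.det (Matrix.of fun i j : Fin N => z j ^ ((N : ℤ) - 1 - (i : ℕ)))

/-- The entry in row `i` of a column of the interleaved confluent matrix
`(a, b, a u, b u, a u², …)`. -/
def interleavedRow (a b u : F) (i : ℕ) : F := (if i % 2 = 0 then a else b) * u ^ (i / 2)

/-- The determinant with rows `a, b, a u, b u, a u², …`. -/
def interleavedDet (n : ℕ) (a b u : Fin n → F) : F :=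
  Matrix.det (Matrix.of fun i j : Fin n => interleavedRow (a j) (b j) (u j) i)

lemma interleavedRow_add_two (a b u : F) (i : ℕ) :
    interleavedRow a b u (i + 2) = u * interleavedRow a b u i := by
  have h1 : (i + 2) % 2 = i % 2 := by omega
  have h2 : (i + 2) / 2 = i / 2 + 1 := by omega
  simp only [interleavedRow, h1, h2, pow_succ]
  ring

lemma det_sub_shift_two {n : ℕ} (A : Matrix (Fin n) (Fin n) F) (t : F) :
    Matrix.det (Matrix.of fun i j : Fin n =>
      if h : 2 ≤ (i : ℕ) then A i j - t * A ⟨i - 2, by omega⟩ j else A i j) = A.det := by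
  let L : Matrix (Fin n) (Fin n) F := Matrix.of fun i l =>
    (if l = i then 1 else 0) + (if (l : ℕ) + 2 = i then -t else 0)
  have hL : L.det = 1 := by
    rw [Matrix.det_of_isLowerTriangular]
    · refine Finset.prod_eq_one fun i _ => ?_
      simp [L]
    · intro i l hil
      have : (i : ℕ) < l := hil
      have h1 : l ≠ i := by rintro rfl; omega
      have h2 : (l : ℕ) + 2 ≠ i := by omega
      simp [L, h1, h2]
  rw [← one_mul A.det, ← hL, ← Matrix.det_mul]
  congr 1
  ext i j
  simp only [Matrix.mul_apply, L, Matrix.of_apply, add_mul, Finset.sum_add_distrib]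
  simp only [ite_mul, one_mul, zero_mul, Finset.sum_ite_eq', Finset.mem_univ, if_true]
  split_ifs with h
  · rw [Finset.sum_eq_single ⟨i - 2, by omega⟩]
    · have : (i : ℕ) - 2 + 2 = i := by omega
      simp [this]; ring
    · intro l _ hl
      rw [if_neg]
      intro h'
      exact hl (Fin.ext (by simp; omega))
    · simp
  · rw [Finset.sum_eq_zero]
    · simp
    · intro l _
      rw [if_neg (by omega)]

/-- If two columns share the same parameter `u`, the determinant splits off these columns. -/
lemma interleavedDet_eq_of_node {n : ℕ} (a b u : Fin (n + 2) → F) (j : Fin (n + 1))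
    (h : u 0 = u j.succ) :
    interleavedDet (n + 2) a b u =
      (-1) ^ (j : ℕ) * (a 0 * b j.succ - b 0 * a j.succ) *
        (∏ l, (u (j.succAbove l).succ - u j.succ)) *
        interleavedDet n (fun l => a (j.succAbove l).succ) (fun l => b (j.succAbove l).succ)
          (fun l => u (j.succAbove l).succ) := by
  have key : ∀ (c : Fin (n + 1) → F),
      Matrix.det (Matrix.of fun i l : Fin (n + 1) => (Fin.cases (c l)
        (fun i' : Fin n => (u l.succ - u j.succ) *
          interleavedRow (a l.succ) (b l.succ) (u l.succ) i') i : F)) =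
      (-1) ^ (j : ℕ) * c j * ((∏ l, (u (j.succAbove l).succ - u j.succ)) *
        interleavedDet n (fun l => a (j.succAbove l).succ) (fun l => b (j.succAbove l).succ)
          (fun l => u (j.succAbove l).succ)) := by
    intro c
    rw [Matrix.det_succ_column _ j, Fin.sum_univ_succ, Finset.sum_eq_zero]
    · simp only [Matrix.of_apply, Fin.cases_zero, Fin.val_zero, zero_add, add_zero,
        Fin.succAbove_zero]
      congr 1
      rw [interleavedDet, ← Matrix.det_mul_row]
      rfl
    · intro i _
      simp
  rw [interleavedDet, ← det_sub_shift_two _ (u j.succ), Matrix.det_succ_column_zero,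
    Fin.sum_univ_succ, Fin.sum_univ_succ, Finset.sum_eq_zero]
  · have e1 := key (fun l => b l.succ)
    have e2 := key (fun l => a l.succ)
    have d1 : (Matrix.of fun i l : Fin (n + 1) => (Fin.cases (b l.succ)
        (fun i' : Fin n => (u l.succ - u j.succ) *
          interleavedRow (a l.succ) (b l.succ) (u l.succ) i') i : F)) =
        (Matrix.of fun i j_1 : Fin (n + 2) => if h : 2 ≤ (i : ℕ) then
          (Matrix.of fun i j : Fin (n + 2) => interleavedRow (a j) (b j) (u j) ↑i) i j_1 -
            u j.succ * (Matrix.of fun i j : Fin (n + 2) => interleavedRow (a j) (b j) (u j) ↑i)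
              ⟨i - 2, by omega⟩ j_1
          else (Matrix.of fun i j : Fin (n + 2) => interleavedRow (a j) (b j) (u j) ↑i) i j_1).submatrix
            (Fin.succAbove 0) Fin.succ := by
      ext i l
      refine Fin.cases ?_ (fun i' => ?_) i
      · simp [interleavedRow]
      · simp [interleavedRow_add_two]; ring
    have d2 : (Matrix.of fun i l : Fin (n + 1) => (Fin.cases (a l.succ)
        (fun i' : Fin n => (u l.succ - u j.succ) *
          interleavedRow (a l.succ) (b l.succ) (u l.succ) i') i : F)) =
        (Matrix.of fun i j_1 : Fin (n + 2) => if h : 2 ≤ (i : ℕ) then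
          (Matrix.of fun i j : Fin (n + 2) => interleavedRow (a j) (b j) (u j) ↑i) i j_1 -
            u j.succ * (Matrix.of fun i j : Fin (n + 2) => interleavedRow (a j) (b j) (u j) ↑i)
              ⟨i - 2, by omega⟩ j_1
          else (Matrix.of fun i j : Fin (n + 2) => interleavedRow (a j) (b j) (u j) ↑i) i j_1).submatrix
            (Fin.succAbove (Fin.succ 0)) Fin.succ := by
      ext i l
      refine Fin.cases ?_ (fun i' => ?_) i
      · simp [interleavedRow]
      · have : (Fin.succAbove (1 : Fin (n + 2)) i'.succ) = i'.succ.succ := by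
          exact Fin.succAbove_of_lt_succ _ _ (by simp [Fin.lt_def])
        simp [interleavedRow_add_two, this]; ring
    rw [← d1, ← d2, e1, e2]
    simp [interleavedRow]
    ring
  · intro i _
    simp [interleavedRow_add_two, h]

/-- `interleavedDet` as a polynomial in the parameter of its first column. -/
def interleavedPoly (n : ℕ) (a b u : Fin n → F) (a₀ b₀ : F) : Polynomial F :=
  ∑ i : Fin (n + 1), Polynomial.C ((-1) ^ (i : ℕ) * (if (i : ℕ) % 2 = 0 then a₀ else b₀) *
    Matrix.det (Matrix.of fun i' j : Fin n =>
      interleavedRow (a j) (b j) (u j) (i.succAbove i'))) * Polynomial.X ^ ((i : ℕ) / 2)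

lemma eval_interleavedPoly (n : ℕ) (a b u : Fin n → F) (a₀ b₀ t : F) :
    (interleavedPoly n a b u a₀ b₀).eval t =
      interleavedDet (n + 1) (Fin.cons a₀ a) (Fin.cons b₀ b) (Fin.cons t u) := by
  rw [interleavedDet, Matrix.det_succ_column_zero, interleavedPoly, Polynomial.eval_finsetSum]
  refine Finset.sum_congr rfl fun i _ => ?_
  have : (Matrix.of fun i' j : Fin n => interleavedRow (a j) (b j) (u j) (i.succAbove i')) =
      (Matrix.of fun i j : Fin (n + 1) => interleavedRow ((Fin.cons a₀ a : Fin (n + 1) → F) j)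
        ((Fin.cons b₀ b : Fin (n + 1) → F) j) ((Fin.cons t u : Fin (n + 1) → F) j) ↑i).submatrix
          i.succAbove Fin.succ := by
    ext i' j
    simp
  rw [← this]
  simp only [Polynomial.eval_mul, Polynomial.eval_C, Polynomial.eval_pow, Polynomial.eval_X,
    Matrix.of_apply, interleavedRow, Fin.cons_zero]
  ring

lemma natDegree_interleavedPoly_le (k : ℕ) (a b u : Fin (2 * k + 1) → F) (a₀ b₀ : F) :
    (interleavedPoly (2 * k + 1) a b u a₀ b₀).natDegree ≤ k := by
  refine Polynomial.natDegree_sum_le_of_forall_le _ _ fun i _ => ?_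
  exact (Polynomial.natDegree_C_mul_X_pow_le _ _).trans (by omega)

lemma coeff_interleavedPoly (k : ℕ) (a b u : Fin (2 * k + 1) → F) (b₀ : F) :
    (interleavedPoly (2 * k + 1) a b u 0 b₀).coeff k =
      - b₀ * interleavedDet (2 * k + 1) a b u := by
  rw [interleavedPoly, Polynomial.finsetSum_coeff, Fin.sum_univ_castSucc, Finset.sum_eq_zero]
  · have h1 : (2 * k + 1) % 2 = 1 := by omega
    have h2 : (2 * k + 1) / 2 = k := by omega
    have h3 : (-1 : F) ^ (2 * k + 1) = -1 := by
      rw [pow_succ, pow_mul]; simp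
    rw [Polynomial.coeff_C_mul_X_pow]
    simp [h1, h2, h3, interleavedDet]
  · intro i _
    rw [Polynomial.coeff_C_mul_X_pow]
    split_ifs with h h'
    · simp
    · have := i.isLt
      simp at h h'
      omega
    · rfl

/-- Lagrange interpolation of a product of two interleaved determinants. -/
lemma interleavedPoly_mul_interleavedPoly (k : ℕ) (a b c d u : Fin (2 * k + 1) → F)
    (hu : Function.Injective u) (a₀ b₀ c₀ d₀ : F) :
    interleavedPoly (2 * k + 1) a b u a₀ b₀ * interleavedPoly (2 * k + 1) c d u c₀ d₀ =
      ∑ j : Fin (2 * k + 1), Polynomial.C ((a₀ * b j - b₀ * a j) * (c₀ * d j - d₀ * c j) *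
        (∏ l, (u (j.succAbove l) - u j)) *
        (interleavedDet (2 * k) (a ∘ j.succAbove) (b ∘ j.succAbove) (u ∘ j.succAbove) *
        interleavedDet (2 * k) (c ∘ j.succAbove) (d ∘ j.succAbove) (u ∘ j.succAbove))) *
        ∏ l, (Polynomial.X - Polynomial.C (u (j.succAbove l))) := by
  refine Polynomial.eq_of_degrees_lt_of_eval_index_eq (v := u) Finset.univ hu.injOn ?_ ?_ ?_
  · refine (Polynomial.degree_le_of_natDegree_le (n := 2 * k) ?_).trans_lt ?_
    · refine Polynomial.natDegree_mul_le.trans ?_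
      have h1 := natDegree_interleavedPoly_le k a b u a₀ b₀
      have h2 := natDegree_interleavedPoly_le k c d u c₀ d₀
      omega
    · simp; norm_cast; omega
  · refine (Polynomial.degree_le_of_natDegree_le (n := 2 * k) ?_).trans_lt ?_
    · refine Polynomial.natDegree_sum_le_of_forall_le _ _ fun i _ => ?_
      refine (Polynomial.natDegree_C_mul_le _ _).trans ?_
      rw [Polynomial.natDegree_prod_of_monic _ _ fun l _ => Polynomial.monic_X_sub_C _]
      simp
    · simp; norm_cast; omega
  · intro j _
    rw [Polynomial.eval_mul, eval_interleavedPoly, eval_interleavedPoly,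
      interleavedDet_eq_of_node _ _ _ j (by simp), interleavedDet_eq_of_node _ _ _ j (by simp),
      Polynomial.eval_finsetSum, Finset.sum_eq_single j]
    · have hs : ((-1 : F) ^ (j : ℕ)) * (-1) ^ (j : ℕ) = 1 := by
        rw [← mul_pow]; simp
      have hp : ∏ l, (u j - u (j.succAbove l)) = ∏ l, (u (j.succAbove l) - u j) := by
        rw [← Finset.prod_congr rfl fun l _ => neg_sub (u (j.succAbove l)) (u j),
          Finset.prod_neg]
        simp
      simp only [Fin.cons_zero, Fin.cons_succ, Polynomial.eval_mul, Polynomial.eval_C,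
        Polynomial.eval_prod, Polynomial.eval_sub, Polynomial.eval_X, hp, Function.comp_def]
      linear_combination (a₀ * b j - b₀ * a j) * (c₀ * d j - d₀ * c j) *
        (∏ l, (u (j.succAbove l) - u j)) ^ 2 *
        (interleavedDet (2 * k) (fun l => a (j.succAbove l)) (fun l => b (j.succAbove l))
          (fun l => u (j.succAbove l)) *
        interleavedDet (2 * k) (fun l => c (j.succAbove l)) (fun l => d (j.succAbove l))
          (fun l => u (j.succAbove l))) * hs
    · intro i _ hij
      obtain ⟨l, hl⟩ := Fin.exists_succAbove_eq hij.symm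
      have h0 : ∏ l, (Polynomial.X - Polynomial.C (u (i.succAbove l))).eval (u j) = 0 :=
        Finset.prod_eq_zero (Finset.mem_univ l) (by simp [hl])
      rw [Polynomial.eval_mul, Polynomial.eval_prod, h0, mul_zero]
    · simp

lemma interleavedDet_mul_interleavedDet_even (k : ℕ) (a b c d u : Fin (2 * k + 2) → F)
    (hu : Function.Injective u) :
    interleavedDet (2 * k + 2) a b u * interleavedDet (2 * k + 2) c d u =
      ∑ j : Fin (2 * k + 1), (a 0 * b j.succ - b 0 * a j.succ) *
        (c 0 * d j.succ - d 0 * c j.succ) *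
        (∏ l, (u (j.succAbove l).succ - u j.succ)) * (∏ l, (u (j.succAbove l).succ - u 0)) *
        (interleavedDet (2 * k) (fun l => a (j.succAbove l).succ)
          (fun l => b (j.succAbove l).succ) (fun l => u (j.succAbove l).succ) *
        interleavedDet (2 * k) (fun l => c (j.succAbove l).succ)
          (fun l => d (j.succAbove l).succ) (fun l => u (j.succAbove l).succ)) := by
  have h := congrArg (Polynomial.eval (u 0)) (interleavedPoly_mul_interleavedPoly k
    (Fin.tail a) (Fin.tail b) (Fin.tail c) (Fin.tail d) (Fin.tail u)
    (hu.comp (Fin.succ_injective _)) (a 0) (b 0) (c 0) (d 0))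
  rw [Polynomial.eval_mul, eval_interleavedPoly, eval_interleavedPoly] at h
  simp only [Fin.cons_self_tail] at h
  rw [h, Polynomial.eval_finsetSum]
  refine Finset.sum_congr rfl fun j _ => ?_
  have hp : ∏ l, (u 0 - u (j.succAbove l).succ) = ∏ l, (u (j.succAbove l).succ - u 0) := by
    rw [← Finset.prod_congr rfl fun l _ => neg_sub (u (j.succAbove l).succ) (u 0),
      Finset.prod_neg]
    simp
  simp only [Polynomial.eval_mul, Polynomial.eval_C, Polynomial.eval_prod, Polynomial.eval_sub,
    Polynomial.eval_X, Function.comp_def, Fin.tail, hp]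
  ring

lemma interleavedDet_mul_interleavedDet_odd (k : ℕ) (a b c d u : Fin (2 * k + 1) → F)
    (hu : Function.Injective u) :
    interleavedDet (2 * k + 1) a b u * interleavedDet (2 * k + 1) c d u =
      ∑ j : Fin (2 * k + 1), a j * c j * (∏ l, (u (j.succAbove l) - u j)) *
        (interleavedDet (2 * k) (a ∘ j.succAbove) (b ∘ j.succAbove) (u ∘ j.succAbove) *
        interleavedDet (2 * k) (c ∘ j.succAbove) (d ∘ j.succAbove) (u ∘ j.succAbove)) := by
  have h := congrArg (fun p => Polynomial.coeff p (k + k))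
    (interleavedPoly_mul_interleavedPoly k a b c d u hu 0 1 0 1)
  rw [Polynomial.coeff_mul_add_eq_of_natDegree_le (natDegree_interleavedPoly_le _ _ _ _ _ _)
    (natDegree_interleavedPoly_le _ _ _ _ _ _), coeff_interleavedPoly, coeff_interleavedPoly,
    Polynomial.finsetSum_coeff] at h
  simp only [neg_mul, one_mul, mul_neg, neg_neg] at h
  rw [h]
  refine Finset.sum_congr rfl fun j _ => ?_
  have hm : (∏ l, (Polynomial.X - Polynomial.C (u (j.succAbove l)))).coeff (k + k) = 1 := by
    have h1 := Polynomial.monic_prod_of_monic Finset.univ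
      (fun l => Polynomial.X - Polynomial.C (u (j.succAbove l)))
      fun l _ => Polynomial.monic_X_sub_C _
    have h2 := Polynomial.natDegree_prod_of_monic Finset.univ
      (fun l => Polynomial.X - Polynomial.C (u (j.succAbove l)))
      fun l _ => Polynomial.monic_X_sub_C _
    simp only [Polynomial.natDegree_X_sub_C, Finset.sum_const, Finset.card_univ,
      Fintype.card_fin, smul_eq_mul, mul_one] at h2
    exact (congrArg _ ((two_mul k).symm.trans h2.symm)).trans h1.coeff_natDegree
  rw [Polynomial.coeff_C_mul, hm]
  ring

lemma det_vandermonde_eq_succAbove {n : ℕ} (u : Fin (n + 1) → F) (j : Fin (n + 1)) :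
    (Matrix.vandermonde u).det = (-1) ^ (j : ℕ) * (∏ l, (u (j.succAbove l) - u j)) *
      (Matrix.vandermonde (u ∘ j.succAbove)).det := by
  have h := Matrix.det_permute j.cycleRange.symm (Matrix.vandermonde u)
  rw [Equiv.Perm.sign_symm, Fin.sign_cycleRange] at h
  have h2 : (Matrix.vandermonde u).det =
      (-1) ^ (j : ℕ) * ((Matrix.vandermonde u).submatrix j.cycleRange.symm id).det := by
    rw [h, ← mul_assoc]
    simp [← mul_pow]
  have h3 : (Matrix.vandermonde u).submatrix j.cycleRange.symm id =
      Matrix.vandermonde (u ∘ j.cycleRange.symm) := rfl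
  rw [h2, h3, Matrix.det_vandermonde, Matrix.det_vandermonde, Fin.prod_univ_succ,
    Fin.prod_Ioi_zero, mul_assoc]
  simp only [Fin.prod_Ioi_succ, Function.comp, Fin.cycleRange_symm_zero, Fin.cycleRange_symm_succ]

section PairSums

variable {X ι : Type*} [Fintype ι]

/-- The row functions `f (P 0), g (P 0), f (P 1), g (P 1), …`. -/
def pairRow (f g : ι → X → F) {k : ℕ} (P : Fin k → ι) (i : Fin (2 * k)) (x : X) : F :=
  if (i : ℕ) % 2 = 0 then f (P ⟨i / 2, by omega⟩) x else g (P ⟨i / 2, by omega⟩) x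

/-- The sum of all determinants whose rows are consecutive pairs `f p, g p`. -/
def pairSum (f g : ι → X → F) (k : ℕ) (w : Fin (2 * k) → X) : F :=
  ∑ P : Fin k → ι, Matrix.det (Matrix.of fun i j => pairRow f g P i (w j))

/-- The sum of all determinants whose first row is `r` and whose other rows are consecutive
pairs `f p, g p`. -/
def borderedPairSum (r : X → F) (f g : ι → X → F) (k : ℕ) (w : Fin (2 * k + 1) → X) : F :=
  ∑ P : Fin k → ι, Matrix.det (Matrix.of fun i j : Fin (2 * k + 1) =>
    (Fin.cases (r (w j)) (fun i' => pairRow f g P i' (w j)) i : F))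

lemma borderedPairSum_eq (r : X → F) (f g : ι → X → F) (k : ℕ) (w : Fin (2 * k + 1) → X) :
    borderedPairSum r f g k w =
      ∑ i : Fin (2 * k + 1), (-1) ^ (i : ℕ) * r (w i) * pairSum f g k (w ∘ i.succAbove) := by
  simp only [borderedPairSum, pairSum, Finset.mul_sum]
  rw [Finset.sum_comm]
  refine Finset.sum_congr rfl fun P _ => ?_
  rw [Matrix.det_succ_row_zero]
  rfl

lemma det_succ_succ_rows {n : ℕ} (B : Matrix (Fin (n + 2)) (Fin (n + 2)) F) :
    B.det = ∑ i : Fin (n + 2), ∑ j : Fin (n + 1), (-1) ^ (i : ℕ) * (-1) ^ (j : ℕ) *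
      (B 0 i * B 1 (i.succAbove j)) *
      (B.submatrix (fun l => l.succ.succ) (fun l => i.succAbove (j.succAbove l))).det := by
  rw [Matrix.det_succ_row_zero]
  refine Finset.sum_congr rfl fun i _ => ?_
  rw [Matrix.det_succ_row_zero, Finset.mul_sum]
  refine Finset.sum_congr rfl fun j _ => ?_
  simp only [Matrix.submatrix_apply, Matrix.submatrix_submatrix, Fin.succ_zero_eq_one]
  rw [show (Fin.succ ∘ Fin.succ : Fin n → Fin (n + 2)) = fun l => l.succ.succ from rfl,
    show (i.succAbove ∘ j.succAbove) = fun l => i.succAbove (j.succAbove l) from rfl]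
  ring

lemma two_mul_det_succ_succ_rows {n : ℕ} (B : Matrix (Fin (n + 2)) (Fin (n + 2)) F) :
    2 * B.det = ∑ i : Fin (n + 2), ∑ j : Fin (n + 1), (-1) ^ (i : ℕ) * (-1) ^ (j : ℕ) *
      (B 0 i * B 1 (i.succAbove j) - B 1 i * B 0 (i.succAbove j)) *
      (B.submatrix (fun l => l.succ.succ) (fun l => i.succAbove (j.succAbove l))).det := by
  have h1 := det_succ_succ_rows B
  have h2 := det_succ_succ_rows (B.submatrix (Equiv.swap (0 : Fin (n + 2)) 1) id)
  rw [Matrix.det_permute, Equiv.Perm.sign_swap (by simp)] at h2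
  have e : ∀ l : Fin n, Equiv.swap (0 : Fin (n + 2)) 1 l.succ.succ = l.succ.succ := fun l =>
    Equiv.swap_apply_of_ne_of_ne (Fin.succ_ne_zero _)
      (by rw [← Fin.succ_zero_eq_one]; exact fun h => Fin.succ_ne_zero _ (Fin.succ_injective _ h))
  simp only [Matrix.submatrix_apply, Matrix.submatrix_submatrix, Function.comp_def, id, e,
    Equiv.swap_apply_left, Equiv.swap_apply_right] at h2
  simp only [mul_sub, sub_mul, Finset.sum_sub_distrib]
  rw [← h1, ← h2]
  simp
  ring

lemma two_mul_pairSum_succ (f g : ι → X → F) (k : ℕ) (w : Fin (2 * k + 2) → X) :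
    2 * pairSum f g (k + 1) w =
      ∑ i : Fin (2 * k + 2), ∑ j : Fin (2 * k + 1), (-1) ^ (i : ℕ) * (-1) ^ (j : ℕ) *
        (∑ p, (f p (w i) * g p (w (i.succAbove j)) - g p (w i) * f p (w (i.succAbove j)))) *
        pairSum f g k (fun l => w (i.succAbove (j.succAbove l))) := by
  have h : ∀ (p : ι) (P : Fin k → ι),
      2 * Matrix.det (Matrix.of fun i j => pairRow f g (Fin.cons p P : Fin (k + 1) → ι) i (w j)) =
      ∑ i : Fin (2 * k + 2), ∑ j : Fin (2 * k + 1), (-1) ^ (i : ℕ) * (-1) ^ (j : ℕ) *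
        (f p (w i) * g p (w (i.succAbove j)) - g p (w i) * f p (w (i.succAbove j))) *
        Matrix.det (Matrix.of fun i' l => pairRow f g P i' (w (i.succAbove (j.succAbove l)))) := by
    intro p P
    refine (two_mul_det_succ_succ_rows (n := 2 * k) (Matrix.of fun i j =>
      pairRow f g (Fin.cons p P : Fin (k + 1) → ι) i (w j))).trans ?_
    refine Finset.sum_congr rfl fun i _ => Finset.sum_congr rfl fun j _ => ?_
    have e0 : ∀ x, pairRow f g (Fin.cons p P : Fin (k + 1) → ι) (0 : Fin (2 * k + 2)) x =
        f p x := fun x => by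
      have h0 : (⟨((0 : Fin (2 * k + 2)) : ℕ) / 2, by simp⟩ : Fin (k + 1)) = 0 :=
        Fin.ext (by simp)
      simp only [pairRow, h0, Fin.cons_zero]
      simp
    have e1 : ∀ x, pairRow f g (Fin.cons p P : Fin (k + 1) → ι) (1 : Fin (2 * k + 2)) x =
        g p x := fun x => by
      have h0 : (⟨((1 : Fin (2 * k + 2)) : ℕ) / 2, by simp⟩ : Fin (k + 1)) = 0 :=
        Fin.ext (by simp)
      simp only [pairRow, h0, Fin.cons_zero]
      simp
    simp only [Matrix.of_apply, e0, e1]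
    refine congrArg (_ * ·) (congrArg Matrix.det ?_)
    ext i' l
    have h1 : ((i' : ℕ) + 1 + 1) % 2 = i' % 2 := by omega
    have h2 : (⟨((i' : ℕ) + 1 + 1) / 2, by omega⟩ : Fin (k + 1)) =
        Fin.succ ⟨i' / 2, by omega⟩ := Fin.ext (by simp; omega)
    simp only [Matrix.submatrix_apply, Matrix.of_apply, pairRow, Fin.val_succ, h1, h2,
      Fin.cons_succ]
  have e : pairSum f g (k + 1) w = ∑ p, ∑ P : Fin k → ι,
      Matrix.det (Matrix.of fun i j =>
        pairRow f g (Fin.cons p P : Fin (k + 1) → ι) i (w j)) := by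
    rw [pairSum, ← (Fin.consEquiv fun _ : Fin (k + 1) => ι).sum_comp, Fintype.sum_prod_type]
    rfl
  simp only [e, Finset.mul_sum, h]
  simp only [pairSum, Finset.mul_sum, Finset.sum_mul]
  rw [Finset.sum_congr rfl fun p _ => Finset.sum_comm]
  rw [Finset.sum_comm]
  refine Finset.sum_congr rfl fun i _ => ?_
  rw [Finset.sum_congr rfl fun p _ => Finset.sum_comm]
  rw [Finset.sum_comm]
  refine Finset.sum_congr rfl fun j _ => ?_
  exact Finset.sum_comm

variable [CharZero F]

/-- Evaluation of a sum of paired determinants as a product of two determinants. -/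
theorem pairSum_mul_det_vandermonde (f g : ι → X → F) (a b c d u : X → F) (κ : F)
    (hA : ∀ x y, (∑ p, (f p x * g p y - g p x * f p y)) * (u x - u y) =
      κ * ((a x * b y - b x * a y) * (c x * d y - d x * c y)))
    (k : ℕ) (w : Fin (2 * k) → X) (hw : Function.Injective (u ∘ w)) :
    pairSum f g k w * (Matrix.vandermonde (u ∘ w)).det =
      (-κ) ^ k * k.factorial * (interleavedDet (2 * k) (a ∘ w) (b ∘ w) (u ∘ w) *
        interleavedDet (2 * k) (c ∘ w) (d ∘ w) (u ∘ w)) := by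
  induction k with
  | zero =>
    have : IsEmpty (Fin (2 * 0)) := inferInstanceAs (IsEmpty (Fin 0))
    simp [pairSum, interleavedDet]
  | succ k ih =>
    have hrow : ∀ i : Fin (2 * k + 2),
        ∑ j : Fin (2 * k + 1), (-1) ^ (i : ℕ) * (-1) ^ (j : ℕ) *
          (∑ p, (f p (w i) * g p (w (i.succAbove j)) - g p (w i) * f p (w (i.succAbove j)))) *
          pairSum f g k (fun l => w (i.succAbove (j.succAbove l))) *
          (Matrix.vandermonde (u ∘ w)).det =
        (-κ) ^ (k + 1) * k.factorial * (interleavedDet (2 * (k + 1)) (a ∘ w) (b ∘ w) (u ∘ w) *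
        interleavedDet (2 * (k + 1)) (c ∘ w) (d ∘ w) (u ∘ w)) := by
      intro i
      have hperm : ∀ a b : X → F, interleavedDet (2 * (k + 1)) (a ∘ w) (b ∘ w) (u ∘ w) =
          (-1) ^ (i : ℕ) * interleavedDet (2 * k + 2) (a ∘ w ∘ i.cycleRange.symm)
            (b ∘ w ∘ i.cycleRange.symm) (u ∘ w ∘ i.cycleRange.symm) := by
        intro a b
        have h := Matrix.det_permute' i.cycleRange.symm (Matrix.of fun i j : Fin (2 * k + 2) =>
          interleavedRow (a (w j)) (b (w j)) (u (w j)) i)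
        rw [Equiv.Perm.sign_symm, Fin.sign_cycleRange] at h
        have h' : interleavedDet (2 * k + 2) (a ∘ w ∘ i.cycleRange.symm)
            (b ∘ w ∘ i.cycleRange.symm) (u ∘ w ∘ i.cycleRange.symm) = _ := h
        rw [h', ← mul_assoc]
        simp [← mul_pow, interleavedDet]
        rfl
      rw [hperm a b, hperm c d, mul_mul_mul_comm ((-1) ^ (i : ℕ)), ← mul_pow, neg_one_mul, neg_neg, one_pow,
        one_mul, interleavedDet_mul_interleavedDet_even k _ _ _ _ _
          (by rw [← Function.comp_assoc]; exact hw.comp (Equiv.injective _)), Finset.mul_sum]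
      refine Finset.sum_congr rfl fun j _ => ?_
      have hinj : Function.Injective (u ∘ fun l => w (i.succAbove (j.succAbove l))) := by
        intro l l' h
        exact Fin.succAbove_right_injective (Fin.succAbove_right_injective (hw h))
      have hk := ih _ hinj
      have hV := det_vandermonde_eq_succAbove (n := 2 * k + 1) (u ∘ w) i
      rw [det_vandermonde_eq_succAbove _ j, Fin.prod_univ_succAbove _ j] at hV
      have hV' : (Matrix.vandermonde (u ∘ w)).det = _ := hV
      rw [hV']
      simp only [Function.comp_def, Fin.cycleRange_symm_zero, Fin.cycleRange_symm_succ] at hk ⊢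
      have hAij := hA (w i) (w (i.succAbove j))
      have hs : ((-1 : F) ^ (i : ℕ)) ^ 2 = 1 := by rw [← pow_mul, mul_comm, pow_mul]; simp
      have hs' : ((-1 : F) ^ (j : ℕ)) ^ 2 = 1 := by rw [← pow_mul, mul_comm, pow_mul]; simp
      generalize (Matrix.vandermonde fun l => u (w (i.succAbove (j.succAbove l)))).det = V at *
      generalize pairSum f g k (fun l => w (i.succAbove (j.succAbove l))) = S at *
      generalize ∏ l, (u (w (i.succAbove (j.succAbove l))) - u (w (i.succAbove j))) = p1 at *
      generalize ∏ l, (u (w (i.succAbove (j.succAbove l))) - u (w i)) = p2 at *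
      generalize ∑ p, (f p (w i) * g p (w (i.succAbove j)) -
        g p (w i) * f p (w (i.succAbove j))) = A at *
      generalize interleavedDet (2 * k) (fun l => a (w (i.succAbove (j.succAbove l))))
        (fun l => b (w (i.succAbove (j.succAbove l))))
        (fun l => u (w (i.succAbove (j.succAbove l)))) = D1 at *
      generalize interleavedDet (2 * k) (fun l => c (w (i.succAbove (j.succAbove l))))
        (fun l => d (w (i.succAbove (j.succAbove l))))
        (fun l => u (w (i.succAbove (j.succAbove l)))) = D2 at *
      generalize (-1 : F) ^ (i : ℕ) = s at *
      generalize (-1 : F) ^ (j : ℕ) = s' at *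
      generalize u (w i) = ui at *
      generalize u (w (i.succAbove j)) = uj at *
      rw [pow_succ]
      calc _ = s ^ 2 * s' ^ 2 * (A * (uj - ui)) * p1 * p2 * (S * V) := by ring
        _ = _ := by
          rw [hs, hs', hk, show A * (uj - ui) = -(A * (ui - uj)) by ring, hAij]
          ring
    have h2 := congrArg (· * (Matrix.vandermonde (u ∘ w)).det) (two_mul_pairSum_succ f g k w)
    simp only [Finset.sum_mul] at h2
    rw [Finset.sum_congr rfl fun i _ => hrow i, Finset.sum_const, Finset.card_univ,
      Fintype.card_fin, nsmul_eq_mul] at h2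
    have h3 : (2 : F) ≠ 0 := two_ne_zero
    apply mul_left_cancel₀ h3
    rw [← mul_assoc, h2, Nat.factorial_succ]
    push_cast
    ring

theorem borderedPairSum_mul_det_vandermonde (r : X → F) (f g : ι → X → F)
    (a b c d u : X → F) (κ : F)
    (hA : ∀ x y, (∑ p, (f p x * g p y - g p x * f p y)) * (u x - u y) =
      κ * ((a x * b y - b x * a y) * (c x * d y - d x * c y)))
    (hr : ∀ x, r x = a x * c x)
    (k : ℕ) (w : Fin (2 * k + 1) → X) (hw : Function.Injective (u ∘ w)) :
    borderedPairSum r f g k w * (Matrix.vandermonde (u ∘ w)).det =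
      (-κ) ^ k * k.factorial * (interleavedDet (2 * k + 1) (a ∘ w) (b ∘ w) (u ∘ w) *
        interleavedDet (2 * k + 1) (c ∘ w) (d ∘ w) (u ∘ w)) := by
  rw [borderedPairSum_eq, interleavedDet_mul_interleavedDet_odd k _ _ _ _ _ hw,
    Finset.sum_mul, Finset.mul_sum]
  refine Finset.sum_congr rfl fun i _ => ?_
  have hs : ((-1 : F) ^ (i : ℕ)) ^ 2 = 1 := by rw [← pow_mul, mul_comm, pow_mul]; simp
  have hk := pairSum_mul_det_vandermonde f g a b c d u κ hA k (w ∘ i.succAbove)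
    (hw.comp Fin.succAbove_right_injective)
  rw [det_vandermonde_eq_succAbove _ i, hr]
  simp only [Function.comp_def] at hk ⊢
  linear_combination (a (w i) * c (w i) * ∏ l, (u (w (i.succAbove l)) - u (w i))) *
    ((-1) ^ (i : ℕ)) ^ 2 * hk + (-κ) ^ k * k.factorial * (a (w i) * c (w i) *
    ∏ l, (u (w (i.succAbove l)) - u (w i))) *
    (interleavedDet (2 * k) (fun l => a (w (i.succAbove l))) (fun l => b (w (i.succAbove l)))
      (fun l => u (w (i.succAbove l))) *
    interleavedDet (2 * k) (fun l => c (w (i.succAbove l))) (fun l => d (w (i.succAbove l)))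
      (fun l => u (w (i.succAbove l)))) * hs

end PairSums

/-- The odd Laurent polynomial `x ^ l - x ^ (-l)`. -/
def oddPow (x : F) (l : ℕ) : F := x ^ l - x⁻¹ ^ l

lemma sum_oddPow_mul (x y : F) (hx : x ≠ 0) (hy : y ≠ 0) (L : ℕ) :
    4 * ((∑ p ∈ Finset.range L,
      (oddPow x (p + 1) * oddPow y p - oddPow x p * oddPow y (p + 1))) *
      ((x + x⁻¹) - (y + y⁻¹))) * (x ^ (L + 1) * y ^ (L + 1)) =
    ((1 + x ^ L) * (1 + x) * ((1 - y ^ L) * (1 - y)) -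
      (1 - x ^ L) * (1 - x) * ((1 + y ^ L) * (1 + y))) *
    ((1 - x ^ L) * (1 + x) * ((1 + y ^ L) * (1 - y)) -
      (1 + x ^ L) * (1 - x) * ((1 - y ^ L) * (1 + y))) := by
  induction L with
  | zero => simp
  | succ L ih =>
    rw [Finset.sum_range_succ, add_mul, mul_add, add_mul,
      show ∀ A : F, A * (x ^ (L + 1 + 1) * y ^ (L + 1 + 1)) =
        A * (x ^ (L + 1) * y ^ (L + 1)) * (x * y) by intro A; ring, ih]
    simp only [oddPow, inv_pow, pow_succ]
    have hX : x ^ L ≠ 0 := pow_ne_zero _ hx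
    have hY : y ^ L ≠ 0 := pow_ne_zero _ hy
    generalize x ^ L = X at *
    generalize y ^ L = Y at *
    field_simp
    ring

lemma sum_oddPow_kernel_even [CharZero F] (x y : F) (hx : x ≠ 0) (hy : y ≠ 0) (L : ℕ) :
    (∑ p : Fin L, (oddPow x (p + 1) * oddPow y p - oddPow x p * oddPow y (p + 1))) *
      ((x + x⁻¹) - (y + y⁻¹)) =
    1 / 4 * (((1 + x ^ L) * (1 + x) * ((1 - y ^ L) * (1 - y)) -
      (1 - x ^ L) * (1 - x) * ((1 + y ^ L) * (1 + y))) *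
    ((1 - x ^ L) * (1 + x) / x ^ (L + 1) * ((1 + y ^ L) * (1 - y) / y ^ (L + 1)) -
      (1 + x ^ L) * (1 - x) / x ^ (L + 1) * ((1 - y ^ L) * (1 + y) / y ^ (L + 1)))) := by
  have h := sum_oddPow_mul x y hx hy L
  rw [Fin.sum_univ_eq_sum_range
    (fun p => oddPow x (p + 1) * oddPow y p - oddPow x p * oddPow y (p + 1)) L]
  have hX : x ^ (L + 1) ≠ 0 := pow_ne_zero _ hx
  have hY : y ^ (L + 1) ≠ 0 := pow_ne_zero _ hy
  have h4 : (4 : F) ≠ 0 := by norm_num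
  rw [mul_assoc 4, mul_comm 4] at h
  rw [← eq_div_iff h4, ← eq_div_iff (mul_ne_zero hX hY)] at h
  rw [h]
  field_simp

lemma sum_oddPow_kernel_odd [CharZero F] (x y : F) (hx : x ≠ 0) (hy : y ≠ 0) (L : ℕ)
    (hL : 0 < L) :
    (∑ p : Fin L, (oddPow x (p + 1) *
        (oddPow y p - if (p : ℕ) + 1 = L then (y + y⁻¹) * oddPow y L / 4 else 0) -
      (oddPow x p - if (p : ℕ) + 1 = L then (x + x⁻¹) * oddPow x L / 4 else 0) *
        oddPow y (p + 1))) *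
      ((x + x⁻¹) - (y + y⁻¹)) =
    1 / 4 * (((1 + x ^ L) * ((1 - y ^ L) * (y⁻¹ - y)) -
      (1 - x ^ L) * (x⁻¹ - x) * (1 + y ^ L)) *
    ((x ^ L - 1) / x ^ L * (-((1 + y ^ L) * (y⁻¹ - y)) / y ^ L) -
      -((1 + x ^ L) * (x⁻¹ - x)) / x ^ L * ((y ^ L - 1) / y ^ L))) := by
  obtain ⟨M, rfl⟩ : ∃ M, L = M + 1 := ⟨L - 1, by omega⟩
  have h := sum_oddPow_kernel_even x y hx hy (M + 1)
  have e : ∀ p : Fin (M + 1), (oddPow x (p + 1) *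
        (oddPow y p - if (p : ℕ) + 1 = M + 1 then (y + y⁻¹) * oddPow y (M + 1) / 4 else 0) -
      (oddPow x p - if (p : ℕ) + 1 = M + 1 then (x + x⁻¹) * oddPow x (M + 1) / 4 else 0) *
        oddPow y (p + 1)) =
      (oddPow x (p + 1) * oddPow y p - oddPow x p * oddPow y (p + 1)) +
      if p = Fin.last M then
        oddPow x (M + 1) * oddPow y (M + 1) * ((x + x⁻¹) - (y + y⁻¹)) / 4 else 0 := by
    intro p
    by_cases hp : p = Fin.last M
    · subst hp
      simp
      ring
    · have : (p : ℕ) ≠ M := fun h => hp (Fin.ext h)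
      simp [hp, this]
  rw [Finset.sum_congr rfl fun p _ => e p, Finset.sum_add_distrib,
    Finset.sum_ite_eq' Finset.univ (Fin.last M), if_pos (Finset.mem_univ _), add_mul, h]
  simp only [oddPow, inv_pow, pow_succ]
  have hX : x ^ M ≠ 0 := pow_ne_zero _ hx
  have hY : y ^ M ≠ 0 := pow_ne_zero _ hy
  generalize x ^ M = X at *
  generalize y ^ M = Y at *
  field_simp
  ring

lemma sum_eq_factorial_mul_sum_strictAnti {k L : ℕ} (D : (Fin k → Fin L) → F)
    (hperm : ∀ (P : Fin k → Fin L) (σ : Equiv.Perm (Fin k)), D (P ∘ σ) = D P)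
    (hinj : ∀ P, D P ≠ 0 → Function.Injective P) :
    ∑ P, D P = k.factorial * ∑ P with StrictAnti P, D P := by
  have h1 : (k.factorial : F) * ∑ P with StrictAnti P, D P =
      ∑ q ∈ (Finset.univ.filter fun P : Fin k → Fin L => StrictAnti P) ×ˢ
        (Finset.univ : Finset (Equiv.Perm (Fin k))), D (q.1 ∘ q.2) := by
    rw [Finset.sum_product, Finset.mul_sum]
    refine Finset.sum_congr rfl fun P _ => ?_
    simp only [hperm, Finset.sum_const, Finset.card_univ, Fintype.card_perm, Fintype.card_fin,
      nsmul_eq_mul]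
  rw [h1]
  symm
  refine Finset.sum_of_injOn (fun q => q.1 ∘ q.2) ?_ (fun _ _ => Finset.mem_coe.2
    (Finset.mem_univ _)) ?_ fun _ _ => rfl
  · rintro ⟨P, σ⟩ hP ⟨Q, τ⟩ hQ h
    simp only [Finset.coe_product, Set.mem_prod, Finset.coe_filter, Finset.mem_univ, true_and,
      Set.mem_ofPred_eq, Finset.coe_univ, Set.mem_univ, and_true] at hP hQ h
    have hr : Set.range P = Set.range Q := by
      rw [← σ.surjective.range_comp P, ← τ.surjective.range_comp Q, h]
    have hPQ : P = Q := by
      have := (StrictMono.range_inj (hP.dual_right) (hQ.dual_right)).1 (by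
        rw [Set.range_comp, Set.range_comp, hr])
      exact funext fun i => congrFun this i
    subst hPQ
    refine Prod.ext rfl (Equiv.ext fun i => hP.injective (congrFun h i))
  · intro P _ hP
    by_contra h0
    have hPi := hinj P h0
    refine hP ⟨(P ∘ Tuple.sort (OrderDual.toDual ∘ P), (Tuple.sort (OrderDual.toDual ∘ P))⁻¹),
      ?_, ?_⟩
    · simp only [Finset.coe_product, Set.mem_prod, Finset.coe_filter, Finset.mem_univ, true_and,
        Set.mem_ofPred_eq, Finset.coe_univ, Set.mem_univ, and_true]
      have hm : Antitone (P ∘ Tuple.sort (OrderDual.toDual ∘ P)) :=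
        fun i j hij => Tuple.monotone_sort (OrderDual.toDual ∘ P) hij
      exact hm.strictAnti_of_injective (hPi.comp (Equiv.injective _))
    · funext i
      simp

lemma add_le_of_separated {k : ℕ} {P : Fin k → ℕ} (hP : StrictAnti P)
    (hsep : ∀ r s, P r ≠ P s + 1) (d : ℕ) (r s : Fin k) (h : (s : ℕ) = r + d) :
    P s + 2 * d ≤ P r := by
  induction d generalizing s with
  | zero =>
    obtain rfl : s = r := Fin.ext (by omega)
    omega
  | succ d ih =>
    have h1 := ih ⟨r + d, by omega⟩ rfl
    have h2 : P s < P ⟨r + d, by omega⟩ := hP (Fin.lt_def.2 (by simp; omega))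
    have h3 := hsep ⟨r + d, by omega⟩ s
    omega

lemma sum_strictAnti_eq_sum_antitone {k L m : ℕ} (hL : m + 2 * k ≤ L)
    (D : (Fin k → Fin L) → F)
    (h0 : ∀ P, D P ≠ 0 → ∀ r, 1 ≤ (P r : ℕ) ∧ (P r : ℕ) < m + 2 * k ∧
      ∀ s, (P r : ℕ) ≠ P s + 1) :
    ∑ P with StrictAnti P, D P = ∑ ν : Fin k → Fin (m + 1) with Antitone ν,
      D fun r => ⟨ν r + (2 * k - 2 * r - 1), by omega⟩ := by
  symm
  refine Finset.sum_of_injOn (fun ν r => ⟨ν r + (2 * k - 2 * r - 1), by omega⟩) ?_ ?_ ?_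
    fun _ _ => rfl
  · intro ν _ ν' _ h
    funext r
    have := congrArg Fin.val (congrFun h r)
    exact Fin.ext (by simpa using this)
  · intro ν hν
    simp only [Finset.coe_filter, Finset.mem_univ, true_and, Set.mem_ofPred_eq] at hν ⊢
    intro r s hrs
    have h1 : (ν s : ℕ) ≤ ν r := hν hrs.le
    have h2 := Fin.lt_def.1 hrs
    simp only [Fin.lt_def]
    omega
  · intro P hP hPn
    by_contra hD
    simp only [Finset.mem_filter, Finset.mem_univ, true_and] at hP
    have hsep := add_le_of_separated (P := fun r => (P r : ℕ)) (fun r s h => hP h)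
      fun r s => (h0 P hD r).2.2 s
    have hlow : ∀ r : Fin k, 2 * k ≤ P r + 2 * r + 1 := fun r => by
      have hr := r.2
      have h1 := hsep (k - 1 - r) r ⟨k - 1, by omega⟩ (by simp; omega)
      have h2 := (h0 P hD ⟨k - 1, by omega⟩).1
      omega
    have hup : ∀ r : Fin k, (P r : ℕ) + 2 * r < m + 2 * k := fun r => by
      have hr := r.2
      have h1 := hsep r ⟨0, by omega⟩ r (by simp)
      have h2 := (h0 P hD ⟨0, by omega⟩).2.1
      omega
    refine hPn ⟨fun r => ⟨P r + 2 * r + 1 - 2 * k, by have := hup r; omega⟩, ?_, ?_⟩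
    · simp only [Finset.coe_filter, Finset.mem_univ, true_and, Set.mem_ofPred_eq]
      intro r s hrs
      have h1 := Fin.le_def.1 hrs
      have h2 := hsep (s - r) r s (by omega)
      simp only [Fin.le_def]
      omega
    · funext r
      have := hlow r
      exact Fin.ext (by simp only; omega)

lemma exists_le_iff_lt_of_antitone {n m : ℕ} (lam : Fin n → Fin (m + 1))
    (h : Antitone fun i => (lam i : ℕ)) (c : ℕ) :
    ∀ j : Fin n, c ≤ lam j ↔
      (j : ℕ) < (Finset.univ.filter fun j : Fin n => c ≤ (lam j : ℕ)).card := by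
  obtain ⟨a, han, ha⟩ : ∃ a ≤ n, ∀ j : Fin n, c ≤ lam j ↔ (j : ℕ) < a := by
    by_cases hall : ∃ a, ∃ ha : a < n, ¬ c ≤ lam ⟨a, ha⟩
    · obtain ⟨h1, h2⟩ := Nat.find_spec hall
      refine ⟨Nat.find hall, h1.le, fun j => ⟨fun hj => ?_, fun hj => ?_⟩⟩
      · by_contra hlt
        exact h2 (hj.trans (h (Fin.le_def.2 (not_lt.1 hlt))))
      · by_contra hn
        exact Nat.find_min hall hj ⟨j.2, hn⟩
    · push Not at hall
      exact ⟨n, le_rfl, fun j => ⟨fun _ => j.2, fun _ => hall j j.2⟩⟩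
  have hcard : (Finset.univ.filter fun j : Fin n => c ≤ (lam j : ℕ)).card = a := by
    simp only [ha]
    rw [Fin.card_filter_val_lt]
    omega
  rw [hcard]
  exact ha

lemma even_card_columns_iff {k m : ℕ} (lam : Fin (2 * k) → Fin (m + 1))
    (h : Antitone fun i => (lam i : ℕ)) :
    (∀ c : ℕ, 1 ≤ c → c ≤ m →
      Even (Finset.univ.filter fun j : Fin (2 * k) => c ≤ (lam j : ℕ)).card) ↔
    ∀ r : Fin k, lam ⟨2 * r, by omega⟩ = lam ⟨2 * r + 1, by omega⟩ := by
  constructor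
  · intro hc r
    have h1 : (lam ⟨2 * r + 1, by omega⟩ : ℕ) ≤ lam ⟨2 * r, by omega⟩ :=
      h (Fin.le_def.2 (by simp))
    by_contra hne
    have h2 := Fin.val_ne_of_ne hne
    have h3 := exists_le_iff_lt_of_antitone lam h (lam ⟨2 * r, by omega⟩)
    have h4 := (h3 ⟨2 * r, by omega⟩).1 le_rfl
    have h5 := (not_congr (h3 ⟨2 * r + 1, by omega⟩)).1 (by omega)
    obtain ⟨t, ht⟩ := hc (lam ⟨2 * r, by omega⟩) (by omega) (by omega)
    simp only at h4 h5
    omega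
  · intro hr c _ _
    have h3 := exists_le_iff_lt_of_antitone lam h c
    have hle := Finset.card_filter_le (Finset.univ : Finset (Fin (2 * k)))
      fun j => c ≤ (lam j : ℕ)
    rw [Finset.card_univ, Fintype.card_fin] at hle
    generalize (Finset.univ.filter fun j : Fin (2 * k) => c ≤ (lam j : ℕ)).card = a at *
    rw [← Nat.not_odd_iff_even]
    rintro ⟨t, rfl⟩
    have h4 := (h3 ⟨2 * t, by omega⟩).2 (by simp)
    have h5 := hr ⟨t, by omega⟩
    simp only at h5
    rw [h5] at h4
    have h6 := (h3 ⟨2 * t + 1, by omega⟩).1 h4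
    simp at h6

lemma odd_card_columns_iff {k m : ℕ} (lam : Fin (2 * k + 1) → Fin (m + 1))
    (h : Antitone fun i => (lam i : ℕ)) :
    (∀ c : ℕ, 1 ≤ c → c ≤ m →
      Odd (Finset.univ.filter fun j : Fin (2 * k + 1) => c ≤ (lam j : ℕ)).card) ↔
    (lam 0 : ℕ) = m ∧
      ∀ r : Fin k, lam ⟨2 * r + 1, by omega⟩ = lam ⟨2 * r + 2, by omega⟩ := by
  constructor
  · intro hc
    constructor
    · by_contra hne
      obtain ⟨t, ht⟩ := hc m (by omega) le_rfl
      have h3 := (exists_le_iff_lt_of_antitone lam h m 0).2 (by rw [ht, Fin.val_zero]; omega)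
      omega
    intro r
    have h1 : (lam ⟨2 * r + 2, by omega⟩ : ℕ) ≤ lam ⟨2 * r + 1, by omega⟩ :=
      h (Fin.le_def.2 (by simp))
    by_contra hne
    have h2 := Fin.val_ne_of_ne hne
    have h3 := exists_le_iff_lt_of_antitone lam h (lam ⟨2 * r + 1, by omega⟩)
    have h4 := (h3 ⟨2 * r + 1, by omega⟩).1 le_rfl
    have h5 := (not_congr (h3 ⟨2 * r + 2, by omega⟩)).1 (by omega)
    obtain ⟨t, ht⟩ := hc (lam ⟨2 * r + 1, by omega⟩) (by omega) (by omega)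
    simp only at h4 h5
    omega
  · rintro ⟨hm, hr⟩ c _ hcm
    have h3 := exists_le_iff_lt_of_antitone lam h c
    have hle := Finset.card_filter_le (Finset.univ : Finset (Fin (2 * k + 1)))
      fun j => c ≤ (lam j : ℕ)
    rw [Finset.card_univ, Fintype.card_fin] at hle
    generalize (Finset.univ.filter fun j : Fin (2 * k + 1) => c ≤ (lam j : ℕ)).card = a at *
    rw [← Nat.not_even_iff_odd]
    rintro ⟨t, rfl⟩
    have h7 := (h3 0).1 (by omega)
    have h8 : t ≠ 0 := by rintro rfl; simp at h7
    obtain ⟨t, rfl⟩ := Nat.exists_eq_succ_of_ne_zero h8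
    have h4 := (h3 ⟨2 * t + 1, by omega⟩).2 (by simp; omega)
    have h5 := hr ⟨t, by omega⟩
    simp only at h5
    rw [h5] at h4
    have h6 := (h3 ⟨2 * t + 2, by omega⟩).1 h4
    simp at h6
    omega

lemma sum_even_columns {A : Type*} [AddCommMonoid A] {k m : ℕ}
    (φ : (Fin (2 * k) → Fin (m + 1)) → A) :
    ∑ lam ∈ Finset.univ.filter (fun lam : Fin (2 * k) → Fin (m + 1) =>
        (Antitone fun i => (lam i : ℕ)) ∧ ∀ c : ℕ, 1 ≤ c → c ≤ m →
          Even (Finset.univ.filter (fun j : Fin (2 * k) => c ≤ (lam j : ℕ))).card), φ lam =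
    ∑ ν : Fin k → Fin (m + 1) with Antitone ν,
      φ fun i : Fin (2 * k) => ν ⟨i / 2, by omega⟩ := by
  symm
  refine Finset.sum_nbij' (fun ν i => ν ⟨i / 2, by omega⟩) (fun lam r => lam ⟨2 * r, by omega⟩)
    ?_ ?_ ?_ ?_ fun _ _ => rfl
  · intro ν hν
    simp only [Finset.mem_filter, Finset.mem_univ, true_and] at hν ⊢
    have hanti : Antitone fun i : Fin (2 * k) => (ν ⟨i / 2, by omega⟩ : ℕ) := fun i j hij =>
      hν (Fin.le_def.2 (Nat.div_le_div_right (Fin.le_def.1 hij)))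
    refine ⟨hanti, (even_card_columns_iff (fun i : Fin (2 * k) => ν ⟨i / 2, by omega⟩) hanti).2
      fun r => congrArg ν (Fin.ext (by simp only; omega))⟩
  · intro lam hlam
    simp only [Finset.mem_filter, Finset.mem_univ, true_and] at hlam ⊢
    exact fun r s hrs => hlam.1 (Fin.le_def.2 (by simpa using Fin.le_def.1 hrs))
  · intro ν _
    funext r
    exact congrArg ν (Fin.ext (by simp))
  · intro lam hlam
    simp only [Finset.mem_filter, Finset.mem_univ, true_and] at hlam
    have h := (even_card_columns_iff lam hlam.1).1 hlam.2
    funext i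
    rcases Nat.even_or_odd' i.1 with ⟨t, ht | ht⟩
    · exact congrArg lam (Fin.ext (by simp only; omega))
    · have h1 : (⟨2 * ((i : ℕ) / 2) + 1, by omega⟩ : Fin (2 * k)) = i :=
        Fin.ext (by simp only; omega)
      exact (h ⟨i / 2, by omega⟩).trans (congrArg lam h1)

lemma sum_odd_columns {A : Type*} [AddCommMonoid A] {k m : ℕ}
    (φ : (Fin (2 * k + 1) → Fin (m + 1)) → A) :
    ∑ lam ∈ Finset.univ.filter (fun lam : Fin (2 * k + 1) → Fin (m + 1) =>
        (Antitone fun i => (lam i : ℕ)) ∧ ∀ c : ℕ, 1 ≤ c → c ≤ m →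
          Odd (Finset.univ.filter (fun j : Fin (2 * k + 1) => c ≤ (lam j : ℕ))).card), φ lam =
    ∑ ν : Fin k → Fin (m + 1) with Antitone ν,
      φ (Fin.cons (Fin.last m) fun i : Fin (2 * k) => ν ⟨i / 2, by omega⟩) := by
  symm
  refine Finset.sum_nbij' (fun ν => Fin.cons (Fin.last m) fun i : Fin (2 * k) =>
    ν ⟨i / 2, by omega⟩) (fun lam r => lam ⟨2 * r + 1, by omega⟩) ?_ ?_ ?_ ?_ fun _ _ => rfl
  · intro ν hν
    simp only [Finset.mem_filter, Finset.mem_univ, true_and] at hν ⊢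
    have hanti : Antitone fun i => ((Fin.cons (Fin.last m) fun i : Fin (2 * k) =>
        ν ⟨i / 2, by omega⟩ : Fin (2 * k + 1) → Fin (m + 1)) i : ℕ) := by
      intro i j hij
      induction i using Fin.cases with
      | zero => exact Nat.le_of_lt_succ (Fin.is_lt _)
      | succ i =>
        induction j using Fin.cases with
        | zero => exact absurd (Fin.le_def.1 hij) (by simp)
        | succ j =>
          simp only [Fin.cons_succ]
          exact hν (Fin.le_def.2 (Nat.div_le_div_right (Fin.le_def.1
            (Fin.succ_le_succ_iff.1 hij))))
    refine ⟨hanti, (odd_card_columns_iff _ hanti).2 ⟨rfl, fun r => ?_⟩⟩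
    exact congrArg ν (Fin.ext (by simp only; omega))
  · intro lam hlam
    simp only [Finset.mem_filter, Finset.mem_univ, true_and] at hlam ⊢
    exact fun r s hrs => hlam.1 (Fin.le_def.2 (by simpa using Fin.le_def.1 hrs))
  · intro ν _
    funext r
    exact congrArg ν (Fin.ext (by simp only; omega))
  · intro lam hlam
    simp only [Finset.mem_filter, Finset.mem_univ, true_and] at hlam
    obtain ⟨h0, h⟩ := (odd_card_columns_iff lam hlam.1).1 hlam.2
    funext i
    induction i using Fin.cases with
    | zero => exact Fin.ext (by simp [h0])
    | succ i =>
      rw [Fin.cons_succ]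
      rcases Nat.even_or_odd' i.1 with ⟨t, ht | ht⟩
      · exact congrArg lam (Fin.ext (by simp only [Fin.val_succ]; omega))
      · have h1 : (⟨2 * ((i : ℕ) / 2) + 2, by omega⟩ : Fin (2 * k + 1)) = i.succ :=
          Fin.ext (by simp only [Fin.val_succ]; omega)
        exact (h ⟨i / 2, by omega⟩).trans (congrArg lam h1)

section PairDeterminants

variable {X ι : Type*}

lemma pairRow_two_mul {Y : Type*} (f g : ι → X → Y) {k : ℕ} (P : Fin k → ι) (r : Fin k) (x : X) :
    pairRow f g P ⟨2 * r, by omega⟩ x = f (P r) x := by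
  have h : (⟨2 * (r : ℕ) / 2, by omega⟩ : Fin k) = r := Fin.ext (by simp only; omega)
  simp only [pairRow, h]
  rw [if_pos (by omega)]

lemma pairRow_two_mul_add_one {Y : Type*} (f g : ι → X → Y) {k : ℕ} (P : Fin k → ι) (r : Fin k) (x : X) :
    pairRow f g P ⟨2 * r + 1, by omega⟩ x = g (P r) x := by
  have h : (⟨(2 * (r : ℕ) + 1) / 2, by omega⟩ : Fin k) = r := Fin.ext (by simp only; omega)
  simp only [pairRow, h]
  rw [if_neg (by omega)]

lemma det_pairRow_comp_perm (f g : ι → X → F) {k : ℕ} (P : Fin k → ι)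
    (σ : Equiv.Perm (Fin k)) (w : Fin (2 * k) → X) :
    Matrix.det (Matrix.of fun i j => pairRow f g (P ∘ σ) i (w j)) =
      Matrix.det (Matrix.of fun i j => pairRow f g P i (w j)) := by
  let e : Fin k × Fin 2 ≃ Fin (2 * k) := finProdFinEquiv.trans (finCongr (mul_comm k 2))
  let τ : Equiv.Perm (Fin k × Fin 2) := Equiv.prodCongrLeft fun _ => σ
  have he : ∀ q : Fin k × Fin 2, (e q : ℕ) = q.2 + 2 * q.1 := fun q => rfl
  have hsign : Equiv.Perm.sign ((e.symm.trans τ).trans e) = 1 := by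
    rw [Equiv.Perm.sign_symm_trans_trans]
    have := Equiv.Perm.sign_prodCongrLeft (fun _ : Fin 2 => σ)
    rw [this]
    simp
  have h := Matrix.det_permute ((e.symm.trans τ).trans e)
    (Matrix.of fun i j => pairRow f g P i (w j))
  rw [hsign, Units.val_one, Int.cast_one, one_mul] at h
  rw [← h]
  congr 1
  ext i j
  obtain ⟨⟨r, s⟩, rfl⟩ := e.surjective i
  have hτ : ((e.symm.trans τ).trans e) (e (r, s)) = e (σ r, s) := by
    simp [τ, Equiv.prodCongrLeft]
  rw [Matrix.submatrix_apply, hτ, Matrix.of_apply, Matrix.of_apply]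
  obtain rfl | rfl : s = 0 ∨ s = 1 := by omega
  · have h1 : ∀ r : Fin k, e (r, 0) = ⟨2 * r, by omega⟩ := fun r => Fin.ext (by simp [he])
    simp only [h1, id, pairRow_two_mul, Function.comp]
  · have h1 : ∀ r : Fin k, e (r, 1) = ⟨2 * r + 1, by omega⟩ := fun r =>
      Fin.ext (by simp [he, add_comm])
    simp only [h1, id, pairRow_two_mul_add_one, Function.comp]

lemma det_bordered (r : X → F) (f g : ι → X → F) {k : ℕ} (P : Fin k → ι)
    (w : Fin (2 * k + 1) → X) :
    Matrix.det (Matrix.of fun i j : Fin (2 * k + 1) =>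
      (Fin.cases (r (w j)) (fun i' => pairRow f g P i' (w j)) i : F)) =
    ∑ i : Fin (2 * k + 1), (-1) ^ (i : ℕ) * r (w i) *
      Matrix.det (Matrix.of fun i' j => pairRow f g P i' (w (i.succAbove j))) := by
  rw [Matrix.det_succ_row_zero]
  rfl

lemma injective_of_det_pairRow_ne_zero (f g : ι → X → F) {k : ℕ} (P : Fin k → ι)
    (w : Fin (2 * k) → X)
    (h : Matrix.det (Matrix.of fun i j => pairRow f g P i (w j)) ≠ 0) :
    Function.Injective P := by
  intro r s hrs
  by_contra hne
  refine h (Matrix.det_zero_of_row_eq (i := ⟨2 * r, by omega⟩) (j := ⟨2 * s, by omega⟩) ?_ ?_)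
  · intro h'
    exact hne (Fin.ext (by simpa using h'))
  · funext j
    simp only [Matrix.of_apply, pairRow_two_mul, hrs]

lemma det_bordered_comp_perm (r : X → F) (f g : ι → X → F) {k : ℕ} (P : Fin k → ι)
    (σ : Equiv.Perm (Fin k)) (w : Fin (2 * k + 1) → X) :
    Matrix.det (Matrix.of fun i j : Fin (2 * k + 1) =>
      (Fin.cases (r (w j)) (fun i' => pairRow f g (P ∘ σ) i' (w j)) i : F)) =
    Matrix.det (Matrix.of fun i j : Fin (2 * k + 1) =>
      (Fin.cases (r (w j)) (fun i' => pairRow f g P i' (w j)) i : F)) := by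
  rw [det_bordered r f g _ w, det_bordered r f g _ w]
  exact Finset.sum_congr rfl fun i _ => congrArg _ (det_pairRow_comp_perm f g P σ _)

lemma injective_of_det_bordered_ne_zero (r : X → F) (f g : ι → X → F) {k : ℕ} (P : Fin k → ι)
    (w : Fin (2 * k + 1) → X)
    (h : Matrix.det (Matrix.of fun i j : Fin (2 * k + 1) =>
      (Fin.cases (r (w j)) (fun i' => pairRow f g P i' (w j)) i : F)) ≠ 0) :
    Function.Injective P := by
  rw [det_bordered r f g _ w] at h
  obtain ⟨i, -, hi⟩ := Finset.exists_ne_zero_of_sum_ne_zero h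
  exact injective_of_det_pairRow_ne_zero f g P _ (right_ne_zero_of_mul hi)

end PairDeterminants

/-- The numerator of the symplectic character with highest weight `μ`. -/
def spNum {n : ℕ} (z : Fin n → F) (μ : Fin n → ℕ) : F :=
  Matrix.det (Matrix.of fun i j : Fin n => oddPow (z j) (μ i + n - i))

lemma pairSum_eq_sum_spNum {k : ℕ} (m : ℕ) (z : Fin (2 * k) → F) :
    pairSum (fun (p : Fin (m + 2 * k)) j => oddPow (z j) (p + 1))
      (fun p j => oddPow (z j) p) k id =
    k.factorial * ∑ ν : Fin k → Fin (m + 1) with Antitone ν,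
      spNum z fun i : Fin (2 * k) => ν ⟨i / 2, by omega⟩ := by
  rw [pairSum, sum_eq_factorial_mul_sum_strictAnti _
    (fun P σ => det_pairRow_comp_perm _ _ P σ id)
    (fun P => injective_of_det_pairRow_ne_zero _ _ P id),
    sum_strictAnti_eq_sum_antitone (m := m) le_rfl]
  · congr 1
    refine Finset.sum_congr rfl fun ν _ => ?_
    rw [spNum]
    congr 1
    ext i j
    simp only [Matrix.of_apply, pairRow, id]
    split_ifs with h <;> congr 1 <;> omega
  · intro P hP r
    refine ⟨?_, (P r).2, fun s hs => hP ?_⟩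
    · by_contra h0
      refine hP (Matrix.det_eq_zero_of_row_eq_zero ⟨2 * r + 1, by omega⟩ fun j => ?_)
      rw [Matrix.of_apply, pairRow_two_mul_add_one, show ((P r : ℕ)) = 0 by omega]
      simp [oddPow]
    · refine Matrix.det_zero_of_row_eq (i := ⟨2 * r + 1, by omega⟩) (j := ⟨2 * s, by omega⟩)
        (fun h => ?_) ?_
      · have := congrArg Fin.val h
        simp only at this
        omega
      · funext j
        simp only [Matrix.of_apply, pairRow_two_mul, pairRow_two_mul_add_one, hs]

lemma borderedPairSum_eq_sum_spNum {k : ℕ} (m : ℕ) (z : Fin (2 * k + 1) → F) :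
    borderedPairSum (fun j => oddPow (z j) (m + (2 * k + 1)))
      (fun (p : Fin (m + (2 * k + 1))) j => oddPow (z j) (p + 1))
      (fun p j => oddPow (z j) p - if (p : ℕ) + 1 = m + (2 * k + 1) then
        (z j + (z j)⁻¹) * oddPow (z j) (m + (2 * k + 1)) / 4 else 0) k id =
    k.factorial * ∑ ν : Fin k → Fin (m + 1) with Antitone ν,
      spNum z fun i => ((Fin.cons (Fin.last m) fun i : Fin (2 * k) => ν ⟨i / 2, by omega⟩ :
        Fin (2 * k + 1) → Fin (m + 1)) i : ℕ) := by
  rw [borderedPairSum, sum_eq_factorial_mul_sum_strictAnti,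
    sum_strictAnti_eq_sum_antitone (m := m) (by omega)]
  · congr 1
    refine Finset.sum_congr rfl fun ν _ => ?_
    rw [spNum]
    congr 1
    ext i j
    induction i using Fin.cases with
    | zero => simp
    | succ i =>
      simp only [Matrix.of_apply, pairRow, id, Fin.cases_succ, Fin.cons_succ, Fin.val_succ]
      have hne : ¬ ((ν ⟨i / 2, by omega⟩ : ℕ) + (2 * k - 2 * (i / 2) - 1) + 1 =
        m + (2 * k + 1)) := by omega
      rw [if_neg hne, sub_zero]
      split_ifs with h <;> congr 1 <;> omega
  · intro P hP r
    have hlt : ∀ r, (P r : ℕ) + 1 ≠ m + (2 * k + 1) := by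
      intro r hr
      refine hP (Matrix.det_zero_of_row_eq (i := 0)
        (j := Fin.succ (⟨2 * r, by omega⟩ : Fin (2 * k))) (Fin.succ_ne_zero _).symm ?_)
      funext j
      simp only [Matrix.of_apply, Fin.cases_succ, pairRow_two_mul, hr, Fin.cases_zero]
    refine ⟨?_, by have := hlt r; omega, fun s hs => hP ?_⟩
    · by_contra h0
      refine hP (Matrix.det_eq_zero_of_row_eq_zero
        (Fin.succ (⟨2 * r + 1, by omega⟩ : Fin (2 * k))) fun j => ?_)
      rw [Matrix.of_apply, Fin.cases_succ, pairRow_two_mul_add_one, if_neg (hlt r),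
        show ((P r : ℕ)) = 0 by omega]
      simp [oddPow]
    · refine Matrix.det_zero_of_row_eq (i := Fin.succ (⟨2 * r + 1, by omega⟩ : Fin (2 * k)))
        (j := Fin.succ (⟨2 * s, by omega⟩ : Fin (2 * k))) (fun h => ?_) ?_
      · have := congrArg Fin.val (Fin.succ_injective _ h)
        simp only at this
        omega
      · funext j
        rw [Matrix.of_apply, Matrix.of_apply, Fin.cases_succ, Fin.cases_succ, pairRow_two_mul,
          pairRow_two_mul_add_one, if_neg (hlt r), sub_zero, hs]
  · exact fun P σ => det_bordered_comp_perm (fun j => oddPow (z j) (m + (2 * k + 1))) _ _ P σ id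
  · exact fun P => injective_of_det_bordered_ne_zero
      (fun j => oddPow (z j) (m + (2 * k + 1))) _ _ P id

lemma det_fromBlocks_self_swap {n : ℕ} (A B : Matrix (Fin n) (Fin n) F) :
    (Matrix.fromBlocks A B B A).det = (A + B).det * (A - B).det := by
  have h : Matrix.fromBlocks 1 1 0 1 * Matrix.fromBlocks A B B A * Matrix.fromBlocks 1 (-1) 0 1 =
      Matrix.fromBlocks (A + B) 0 B (A - B) := by
    simp [Matrix.fromBlocks_multiply, add_comm, sub_eq_add_neg]
    abel
  have h2 := congrArg Matrix.det h
  rw [Matrix.det_mul, Matrix.det_mul, Matrix.det_fromBlocks_zero₂₁, Matrix.det_fromBlocks_zero₂₁,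
    Matrix.det_fromBlocks_zero₁₂] at h2
  simpa using h2

lemma exists_det_submatrix_eq {ι κ : Type*} [Fintype ι] [Fintype κ] [DecidableEq ι]
    [DecidableEq κ] (e₁ e₂ : ι ≃ κ) :
    ∃ ε : F, ε ≠ 0 ∧ ∀ M : Matrix κ κ F, (M.submatrix e₁ e₂).det = ε * M.det := by
  refine ⟨((Equiv.Perm.sign (e₂.symm.trans e₁) : ℤ) : F), ?_, fun M => ?_⟩
  · rcases Int.units_eq_one_or (Equiv.Perm.sign (e₂.symm.trans e₁)) with h | h <;> simp [h]
  · rw [← Matrix.det_permute, ← Matrix.det_submatrix_equiv_self e₂, Matrix.submatrix_submatrix]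
    congr 2
    funext i
    simp

/-- The numerator of the Schur function of shape `(m ^ n)` in the variables `x_j, x_j⁻¹`. -/
def rectNum {n : ℕ} (x : Fin n → F) (m : ℕ) : F :=
  Matrix.det (Matrix.of fun i j : Fin (2 * n) =>
    (if (j : ℕ) % 2 = 0 then x ⟨j / 2, by omega⟩ else (x ⟨j / 2, by omega⟩)⁻¹) ^
      ((if (i : ℕ) < n then (m : ℤ) else 0) + ((2 * n : ℕ) : ℤ) - 1 - (i : ℕ)))

/-- The determinant of `x_j ^ i + q_j x_j ^ (n - 1 - i)`. -/
def foldedDet {n : ℕ} (x q : Fin n → F) : F :=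
  Matrix.det (Matrix.of fun i j : Fin n => x j ^ (i : ℕ) + q j * x j ^ (n - 1 - i))

lemma exists_rectNum_mul_prod_eq {n : ℕ} (x : Fin n → F) (hx : ∀ j, x j ≠ 0) :
    ∃ ε : F, ε ≠ 0 ∧ ∀ m : ℕ, ε * rectNum x m * ∏ j, x j ^ (m + 2 * n - 1) =
      foldedDet x (fun j => x j ^ (m + n)) * foldedDet x fun j => -x j ^ (m + n) := by
  let g₁ : Fin n ⊕ Fin n → Fin (2 * n) :=
    Sum.elim (fun i => ⟨2 * n - 1 - i, by omega⟩) fun i => ⟨i, by omega⟩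
  let g₂ : Fin n ⊕ Fin n → Fin (2 * n) :=
    Sum.elim (fun j => ⟨2 * j, by omega⟩) fun j => ⟨2 * j + 1, by omega⟩
  have hcard : Fintype.card (Fin n ⊕ Fin n) = Fintype.card (Fin (2 * n)) := by
    simp [two_mul]
  have h₁ : Function.Bijective g₁ := by
    refine (Fintype.bijective_iff_injective_and_card g₁).2 ⟨?_, hcard⟩
    rintro (i | i) (j | j) h <;> have := congrArg Fin.val h <;> simp [g₁] at this <;>
      first
        | omega
        | exact congrArg _ (Fin.ext (by omega))
  have h₂ : Function.Bijective g₂ := by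
    refine (Fintype.bijective_iff_injective_and_card g₂).2 ⟨?_, hcard⟩
    rintro (i | i) (j | j) h <;> have := congrArg Fin.val h <;> simp [g₂] at this <;>
      first
        | omega
        | exact congrArg _ (Fin.ext (by omega))
  obtain ⟨ε, hε, hdet⟩ := exists_det_submatrix_eq (F := F) (Equiv.ofBijective g₁ h₁)
    (Equiv.ofBijective g₂ h₂)
  refine ⟨ε, hε, fun m => ?_⟩
  let A : Matrix (Fin n) (Fin n) F := Matrix.of fun i j => x j ^ (i : ℕ)
  let B : Matrix (Fin n) (Fin n) F := Matrix.of fun i j => x j ^ (m + n) * x j ^ (n - 1 - (i : ℕ))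
  have hfold : foldedDet x (fun j => x j ^ (m + n)) = (A + B).det := rfl
  have hfold' : foldedDet x (fun j => -x j ^ (m + n)) = (A - B).det := by
    rw [foldedDet]
    congr 1
    ext i j
    simp [A, B, sub_eq_add_neg]
  rw [hfold, hfold', ← det_fromBlocks_self_swap, rectNum, ← hdet, mul_comm]
  have hprod : ∏ j, x j ^ (m + 2 * n - 1) = ∏ s : Fin n ⊕ Fin n,
      Sum.elim (fun _ => 1) (fun j => x j ^ (m + 2 * n - 1)) s := by
    rw [Fintype.prod_sum_type]
    simp
  rw [hprod, ← Matrix.det_mul_row]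
  let ex : Fin (2 * n) → ℕ := fun i => if (i : ℕ) < n then m + 2 * n - 1 - i else 2 * n - 1 - i
  have hex : ∀ i : Fin (2 * n),
      (if (i : ℕ) < n then (m : ℤ) else 0) + ((2 * n : ℕ) : ℤ) - 1 - (i : ℕ) = (ex i : ℤ) := by
    intro i
    simp only [ex]
    split_ifs <;> omega
  have hex_inl : ∀ i : Fin n, ex (g₁ (Sum.inl i)) = i := fun i => by
    have h : ¬ 2 * n - 1 - (i : ℕ) < n := by omega
    simp only [ex, g₁, Sum.elim_inl, if_neg h]
    omega
  have hex_inr : ∀ i : Fin n, ex (g₁ (Sum.inr i)) = m + 2 * n - 1 - i := fun i => by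
    simp only [ex, g₁, Sum.elim_inr, if_pos i.2]
  have hz : ∀ j : Fin n, (if (g₂ (Sum.inl j) : ℕ) % 2 = 0 then x ⟨g₂ (Sum.inl j) / 2, by omega⟩
      else (x ⟨g₂ (Sum.inl j) / 2, by omega⟩)⁻¹) = x j := fun j => by
    have hj : (⟨2 * (j : ℕ) / 2, by omega⟩ : Fin n) = j := Fin.ext (by simp only; omega)
    simp only [g₂, Sum.elim_inl, hj]
    rw [if_pos (by omega)]
  have hz' : ∀ j : Fin n, (if (g₂ (Sum.inr j) : ℕ) % 2 = 0 then x ⟨g₂ (Sum.inr j) / 2, by omega⟩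
      else (x ⟨g₂ (Sum.inr j) / 2, by omega⟩)⁻¹) = (x j)⁻¹ := fun j => by
    have hj : (⟨(2 * (j : ℕ) + 1) / 2, by omega⟩ : Fin n) = j := Fin.ext (by simp only; omega)
    simp only [g₂, Sum.elim_inr, hj]
    rw [if_neg (by omega)]
  congr 1
  ext (i | i) (j | j) <;>
    simp only [Matrix.of_apply, Matrix.submatrix_apply, Equiv.ofBijective_apply, hex, hex_inl,
      hex_inr, hz, hz', zpow_natCast, Sum.elim_inl, Sum.elim_inr, one_mul,
      Matrix.fromBlocks_apply₁₁, Matrix.fromBlocks_apply₁₂, Matrix.fromBlocks_apply₂₁,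
      Matrix.fromBlocks_apply₂₂, A, B, inv_pow,
      mul_inv_eq_iff_eq_mul₀ (pow_ne_zero _ (hx j)), ← pow_add] <;>
    congr 1 <;> omega

lemma det_eval_add_reflect_eq {n : ℕ} (x q : Fin n → F) (hx : ∀ j, x j ≠ 0)
    (f : Fin n → Polynomial F) (hf : ∀ i, (f i).natDegree < n) :
    Matrix.det (Matrix.of fun i j : Fin n =>
      (f i).eval (x j) + q j * (x j ^ (n - 1) * (f i).eval (x j)⁻¹)) =
    Matrix.det (Matrix.of fun i l : Fin n => (f i).coeff l) * foldedDet x q := by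
  rw [foldedDet, ← Matrix.det_mul]
  congr 1
  ext i j
  simp only [Matrix.of_apply, Matrix.mul_apply]
  rw [Polynomial.eval_eq_sum_range' (hf i), Polynomial.eval_eq_sum_range' (hf i), Finset.mul_sum,
    Finset.mul_sum, ← Finset.sum_add_distrib, Finset.sum_range]
  refine Finset.sum_congr rfl fun l _ => ?_
  have h : x j ^ (n - 1) = x j ^ (n - 1 - l) * x j ^ (l : ℕ) := by
    rw [← pow_add]
    congr 1
    omega
  have h0 := pow_ne_zero (l : ℕ) (hx j)
  rw [h, inv_pow]
  field_simp

lemma natDegree_S_and_monic (l : ℕ) :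
    (Polynomial.Chebyshev.S F l).natDegree = l ∧ (Polynomial.Chebyshev.S F l).Monic := by
  induction l using Nat.strong_induction_on with
  | _ l ih =>
    match l with
    | 0 => simp
    | 1 => simp [Polynomial.monic_X]
    | l + 2 =>
      obtain ⟨h1, h2⟩ := ih (l + 1) (by omega)
      obtain ⟨h3, h4⟩ := ih l (by omega)
      push_cast at h1 h2
      have h5 : (Polynomial.X * Polynomial.Chebyshev.S F (l + 1)).natDegree = l + 2 := by
        rw [Polynomial.natDegree_X_mul h2.ne_zero, h1]
      have h6 : (Polynomial.Chebyshev.S F l).degree <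
          (Polynomial.X * Polynomial.Chebyshev.S F (l + 1)).degree := by
        apply Polynomial.degree_lt_degree
        omega
      have h7 : (((l + 2 : ℕ) : ℤ)) = l + 2 := by push_cast; rfl
      rw [h7, Polynomial.Chebyshev.S_add_two]
      refine ⟨?_, (Polynomial.monic_X.mul h2).sub_of_left h6⟩
      rw [Polynomial.natDegree_sub_eq_left_of_natDegree_lt (by omega), h5]

lemma oddPow_succ_eq (x : F) (hx : x ≠ 0) (l : ℕ) :
    oddPow x (l + 1) = (x - x⁻¹) * (Polynomial.Chebyshev.S F l).eval (x + x⁻¹) := by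
  induction l using Nat.strong_induction_on with
  | _ l ih =>
    match l with
    | 0 => simp [oddPow]
    | 1 =>
      simp [oddPow]
      ring
    | l + 2 =>
      have h1 := ih (l + 1) (by omega)
      have h2 := ih l (by omega)
      have h7 : (((l + 2 : ℕ) : ℤ)) = l + 2 := by push_cast; rfl
      rw [h7, Polynomial.Chebyshev.S_add_two]
      push_cast at h1
      rw [Polynomial.eval_sub, Polynomial.eval_mul, Polynomial.eval_X, mul_sub, ← h2,
        mul_left_comm, ← h1]
      simp only [oddPow, inv_pow, pow_succ]
      have hl : x ^ l ≠ 0 := pow_ne_zero _ hx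
      generalize x ^ l = y at *
      field_simp
      ring

lemma spNum_zero_ne_zero {n : ℕ} (x : Fin n → F) (hx : ∀ j, x j ≠ 0) (hx' : ∀ j, x j ≠ (x j)⁻¹)
    (hu : Function.Injective fun j => x j + (x j)⁻¹) : spNum x (fun _ => 0) ≠ 0 := by
  have h1 : (Matrix.of fun i j : Fin n => oddPow (x j) (0 + n - i)) =
      (Matrix.of fun i j : Fin n => (x j - (x j)⁻¹) *
        (Matrix.of fun i j : Fin n => (Polynomial.Chebyshev.S F (j : ℕ)).eval
          (x i + (x i)⁻¹))ᵀ i j).submatrix Fin.revPerm id := by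
    ext i j
    have : 0 + n - (i : ℕ) = (n - (i + 1)) + 1 := by omega
    simp only [Matrix.submatrix_apply, Matrix.of_apply, Matrix.transpose_apply, this, id,
      oddPow_succ_eq _ (hx j), Fin.revPerm_apply, Fin.val_rev]
  rw [spNum, h1, Matrix.det_permute, Matrix.det_mul_row, Matrix.det_transpose,
    ← Matrix.det_eval_matrixOfPolynomials_eq_det_vandermonde _ _
      (fun i => (natDegree_S_and_monic _).1) fun i => (natDegree_S_and_monic _).2]
  refine mul_ne_zero ?_ (mul_ne_zero (Finset.prod_ne_zero_iff.2 fun j _ =>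
    sub_ne_zero.2 (hx' j)) (Matrix.det_vandermonde_ne_zero_iff.2 hu))
  rcases Int.units_eq_one_or (Equiv.Perm.sign (Fin.revPerm (n := n))) with h | h <;> simp [h]

lemma interleavedDet_mul_left {n : ℕ} (t a b u : Fin n → F) :
    interleavedDet n (fun j => t j * a j) (fun j => t j * b j) u =
      (∏ j, t j) * interleavedDet n a b u := by
  rw [interleavedDet, interleavedDet, ← Matrix.det_mul_row]
  congr 1
  ext i j
  simp only [Matrix.of_apply, interleavedRow]
  split_ifs <;> ring

lemma add_inv_pow_eq (x : F) (hx : x ≠ 0) (s : ℕ) : (x + x⁻¹) ^ s = (1 + x ^ 2) ^ s / x ^ s := by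
  rw [← div_pow]
  congr 1
  field_simp
  ring

lemma one_add_inv_sq_pow_eq (x : F) (hx : x ≠ 0) (s : ℕ) :
    (1 + x⁻¹ ^ 2) ^ s = (1 + x ^ 2) ^ s / (x ^ s) ^ 2 := by
  rw [← pow_mul, mul_comm, pow_mul, ← div_pow]
  congr 1
  field_simp
  ring

open Polynomial in
lemma exists_interleavedDet_even_eq {k : ℕ} (x : Fin (2 * k) → F) (hx : ∀ j, x j ≠ 0) :
    ∃ C : F, ∀ q : Fin (2 * k) → F,
      interleavedDet (2 * k) (fun j => (1 + q j) * (1 + x j)) (fun j => (1 - q j) * (1 - x j))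
        (fun j => x j + (x j)⁻¹) * ∏ j, x j ^ (k - 1) = C * foldedDet x q := by
  let f : Fin (2 * k) → F[X] := fun i =>
    (if (i : ℕ) % 2 = 0 then 1 + X else 1 - X) * X ^ (k - 1 - i / 2) * (1 + X ^ 2) ^ ((i : ℕ) / 2)
  have hf : ∀ i, (f i).natDegree < 2 * k := fun i => by
    have h1 : (f i).natDegree ≤ 1 + (k - 1 - i / 2) + (i / 2) * 2 := by
      refine natDegree_mul_le_of_le (natDegree_mul_le_of_le ?_ (natDegree_X_pow_le _))
        (natDegree_pow_le_of_le _ ?_)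
      · split_ifs <;> compute_degree
      · compute_degree
    omega
  refine ⟨_, fun q => (Eq.trans ?_ (det_eval_add_reflect_eq x q hx f hf))⟩
  rw [mul_comm, interleavedDet, ← Matrix.det_mul_row]
  congr 1
  ext i j
  have h0 := hx j
  simp only [Matrix.of_apply, interleavedRow, f]
  have hk : k - 1 = (i : ℕ) / 2 + (k - 1 - i / 2) := by omega
  have hk2 : 2 * k - 1 = ((i : ℕ) / 2) * 2 + (k - 1 - i / 2) * 2 + 1 := by omega
  generalize k - 1 - (i : ℕ) / 2 = t at *
  rw [hk, hk2]
  generalize (i : ℕ) / 2 = s at *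
  have ht : x j ^ t ≠ 0 := pow_ne_zero _ h0
  have hs : x j ^ s ≠ 0 := pow_ne_zero _ h0
  split_ifs <;>
  · simp only [eval_mul, eval_add, eval_sub, eval_one, eval_X, eval_pow, add_inv_pow_eq _ h0,
      one_add_inv_sq_pow_eq _ h0, pow_add, pow_one, pow_mul]
    rw [inv_pow _ t]
    generalize (1 + x j ^ 2) ^ s = y at *
    generalize x j ^ s = xs at *
    generalize x j ^ t = xt at *
    field_simp
    ring

open Polynomial in
lemma exists_interleavedDet_odd_eq {k : ℕ} (x : Fin (2 * k + 1) → F) (hx : ∀ j, x j ≠ 0) :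
    ∃ C : F, ∀ q : Fin (2 * k + 1) → F,
      interleavedDet (2 * k + 1) (fun j => 1 + q j) (fun j => (1 - q j) * ((x j)⁻¹ - x j))
        (fun j => x j + (x j)⁻¹) * ∏ j, x j ^ k = C * foldedDet x q := by
  let f : Fin (2 * k + 1) → F[X] := fun i =>
    (if (i : ℕ) % 2 = 0 then X ^ (k - i / 2) else (1 - X ^ 2) * X ^ (k - i / 2 - 1)) *
      (1 + X ^ 2) ^ ((i : ℕ) / 2)
  have hf : ∀ i, (f i).natDegree < 2 * k + 1 := fun i => by
    have h1 : (f i).natDegree ≤ (if (i : ℕ) % 2 = 0 then k - i / 2 else 2 + (k - i / 2 - 1)) +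
        (i / 2) * 2 := by
      refine natDegree_mul_le_of_le ?_ (natDegree_pow_le_of_le _ ?_)
      · split_ifs
        · exact natDegree_X_pow_le _
        · refine natDegree_mul_le_of_le ?_ (natDegree_X_pow_le _)
          compute_degree
      · compute_degree
    split_ifs at h1 <;> omega
  refine ⟨_, fun q => (Eq.trans ?_ (det_eval_add_reflect_eq x q hx f hf))⟩
  rw [mul_comm, interleavedDet, ← Matrix.det_mul_row]
  congr 1
  ext i j
  have h0 := hx j
  simp only [Matrix.of_apply, interleavedRow, f]
  split_ifs with hi
  · have hk : k = (i : ℕ) / 2 + (k - i / 2) := by omega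
    have hk2 : 2 * k + 1 - 1 = ((i : ℕ) / 2) * 2 + (k - i / 2) * 2 := by omega
    generalize k - (i : ℕ) / 2 = t at *
    rw [hk2]
    generalize (i : ℕ) / 2 = s at *
    subst hk
    have ht : x j ^ t ≠ 0 := pow_ne_zero _ h0
    have hs : x j ^ s ≠ 0 := pow_ne_zero _ h0
    simp only [eval_mul, eval_add, eval_one, eval_X, eval_pow, add_inv_pow_eq _ h0,
      one_add_inv_sq_pow_eq _ h0, pow_add, pow_mul]
    rw [inv_pow _ t]
    generalize (1 + x j ^ 2) ^ s = y at *
    generalize x j ^ s = xs at *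
    generalize x j ^ t = xt at *
    field_simp
  · have hk : k = (i : ℕ) / 2 + (k - i / 2 - 1) + 1 := by omega
    have hk2 : 2 * k + 1 - 1 = ((i : ℕ) / 2) * 2 + (k - i / 2 - 1) * 2 + 2 := by omega
    generalize k - (i : ℕ) / 2 - 1 = t at *
    rw [hk2]
    generalize (i : ℕ) / 2 = s at *
    subst hk
    have ht : x j ^ t ≠ 0 := pow_ne_zero _ h0
    have hs : x j ^ s ≠ 0 := pow_ne_zero _ h0
    simp only [eval_mul, eval_add, eval_sub, eval_one, eval_X, eval_pow, add_inv_pow_eq _ h0,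
      one_add_inv_sq_pow_eq _ h0, pow_add, pow_one, pow_mul]
    rw [inv_pow _ t]
    generalize (1 + x j ^ 2) ^ s = y at *
    generalize x j ^ s = xs at *
    generalize x j ^ t = xt at *
    field_simp
    ring

lemma eq_mul_of_folded_factors {S V c J₁ J₂ W₁ W₂ C ε R T Q p s : F} (hV : V ≠ 0) (hp : p ≠ 0)
    (hS : S * V = c * (J₁ * (T * J₂))) (h₁ : J₁ * p = C * W₁) (h₂ : J₂ * p = C * W₂)
    (hR : ε * R * Q = W₁ * W₂) (hT : T * Q = s * p ^ 2) :
    S = c * C ^ 2 * ε * s / V * R := by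
  have h : S * V * p ^ 2 = c * C ^ 2 * ε * s * R * p ^ 2 := by
    linear_combination p ^ 2 * hS + c * T * p * J₂ * h₁ + c * T * C * W₁ * h₂ -
      c * T * C ^ 2 * hR + c * C ^ 2 * ε * R * hT
  have h' := mul_right_cancel₀ (pow_ne_zero 2 hp) h
  field_simp
  exact h'

lemma exists_sum_spNum_even_eq [CharZero F] {k : ℕ} (hk : 1 ≤ k) (x : Fin (2 * k) → F)
    (hx : ∀ j, x j ≠ 0) (hu : Function.Injective fun j => x j + (x j)⁻¹) :
    ∃ K : F, ∀ m : ℕ, ∑ ν : Fin k → Fin (m + 1) with Antitone ν,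
      spNum x (fun i : Fin (2 * k) => ν ⟨i / 2, by omega⟩) = K * rectNum x m := by
  obtain ⟨C, hC⟩ := exists_interleavedDet_even_eq x hx
  obtain ⟨ε, -, hε⟩ := exists_rectNum_mul_prod_eq x hx
  refine ⟨(-(1 / 4)) ^ k * C ^ 2 * ε * 1 / (Matrix.vandermonde fun j => x j + (x j)⁻¹).det,
    fun m => ?_⟩
  refine eq_mul_of_folded_factors (T := ∏ j, (x j ^ (m + 2 * k + 1))⁻¹)
    (s := 1) (c := (-(1 / 4)) ^ k) (Matrix.det_vandermonde_ne_zero_iff.2 hu)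
    (Finset.prod_ne_zero_iff.2 fun j _ => pow_ne_zero (k - 1) (hx j)) ?_
    (hC fun j => x j ^ (m + 2 * k)) (hC fun j => -x j ^ (m + 2 * k)) (hε m) ?_
  · have h := pairSum_mul_det_vandermonde
      (fun (p : Fin (m + 2 * k)) j => oddPow (x j) (p + 1)) (fun p j => oddPow (x j) p)
      (fun j => (1 + x j ^ (m + 2 * k)) * (1 + x j))
      (fun j => (1 - x j ^ (m + 2 * k)) * (1 - x j))
      (fun j => (1 - x j ^ (m + 2 * k)) * (1 + x j) / x j ^ (m + 2 * k + 1))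
      (fun j => (1 + x j ^ (m + 2 * k)) * (1 - x j) / x j ^ (m + 2 * k + 1))
      (fun j => x j + (x j)⁻¹) (1 / 4)
      (fun i j => sum_oddPow_kernel_even (x i) (x j) (hx i) (hx j) (m + 2 * k)) k id hu
    rw [pairSum_eq_sum_spNum] at h
    apply mul_left_cancel₀ (Nat.cast_ne_zero.2 k.factorial_ne_zero : (k.factorial : F) ≠ 0)
    rw [← interleavedDet_mul_left]
    have e₁ : (fun j => (x j ^ (m + 2 * k + 1))⁻¹ * ((1 + -x j ^ (m + 2 * k)) * (1 + x j))) =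
      fun j => (1 - x j ^ (m + 2 * k)) * (1 + x j) / x j ^ (m + 2 * k + 1) := by
      funext j
      rw [div_eq_inv_mul, sub_eq_add_neg]
    have e₂ : (fun j => (x j ^ (m + 2 * k + 1))⁻¹ * ((1 - -x j ^ (m + 2 * k)) * (1 - x j))) =
      fun j => (1 + x j ^ (m + 2 * k)) * (1 - x j) / x j ^ (m + 2 * k + 1) := by
      funext j
      rw [div_eq_inv_mul, sub_neg_eq_add]
    rw [e₁, e₂, ← mul_assoc]
    refine h.trans ?_
    simp only [Function.comp_def, id]
    ring
  · rw [← Finset.prod_mul_distrib, ← Finset.prod_pow, one_mul]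
    refine Finset.prod_congr rfl fun j _ => ?_
    rw [inv_mul_eq_iff_eq_mul₀ (pow_ne_zero _ (hx j)), ← pow_mul, ← pow_add]
    congr 1
    omega

lemma exists_sum_spNum_odd_eq [CharZero F] {k : ℕ} (x : Fin (2 * k + 1) → F)
    (hx : ∀ j, x j ≠ 0) (hu : Function.Injective fun j => x j + (x j)⁻¹) :
    ∃ K : F, ∀ m : ℕ, ∑ ν : Fin k → Fin (m + 1) with Antitone ν,
      spNum x (fun i => ((Fin.cons (Fin.last m) fun i : Fin (2 * k) => ν ⟨i / 2, by omega⟩ :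
        Fin (2 * k + 1) → Fin (m + 1)) i : ℕ)) = K * rectNum x m := by
  obtain ⟨C, hC⟩ := exists_interleavedDet_odd_eq x hx
  obtain ⟨ε, -, hε⟩ := exists_rectNum_mul_prod_eq x hx
  refine ⟨(-(1 / 4)) ^ k * C ^ 2 * ε * (-1) ^ (2 * k + 1) /
    (Matrix.vandermonde fun j => x j + (x j)⁻¹).det, fun m => ?_⟩
  refine eq_mul_of_folded_factors (T := ∏ j, -(x j ^ (m + (2 * k + 1)))⁻¹)
    (s := (-1) ^ (2 * k + 1)) (c := (-(1 / 4)) ^ k) (Matrix.det_vandermonde_ne_zero_iff.2 hu)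
    (Finset.prod_ne_zero_iff.2 fun j _ => pow_ne_zero k (hx j)) ?_
    (hC fun j => x j ^ (m + (2 * k + 1))) (hC fun j => -x j ^ (m + (2 * k + 1))) (hε m) ?_
  · have h := borderedPairSum_mul_det_vandermonde
      (fun j => oddPow (x j) (m + (2 * k + 1)))
      (fun (p : Fin (m + (2 * k + 1))) j => oddPow (x j) (p + 1))
      (fun p j => oddPow (x j) p - if (p : ℕ) + 1 = m + (2 * k + 1) then
        (x j + (x j)⁻¹) * oddPow (x j) (m + (2 * k + 1)) / 4 else 0)
      (fun j => 1 + x j ^ (m + (2 * k + 1)))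
      (fun j => (1 - x j ^ (m + (2 * k + 1))) * ((x j)⁻¹ - x j))
      (fun j => (x j ^ (m + (2 * k + 1)) - 1) / x j ^ (m + (2 * k + 1)))
      (fun j => -((1 + x j ^ (m + (2 * k + 1))) * ((x j)⁻¹ - x j)) / x j ^ (m + (2 * k + 1)))
      (fun j => x j + (x j)⁻¹) (1 / 4)
      (fun i j => sum_oddPow_kernel_odd (x i) (x j) (hx i) (hx j) (m + (2 * k + 1)) (by omega))
      (fun j => by
        have h0 := pow_ne_zero (m + (2 * k + 1)) (hx j)
        simp only [oddPow, inv_pow]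
        field_simp
        ring) k id hu
    rw [borderedPairSum_eq_sum_spNum] at h
    apply mul_left_cancel₀ (Nat.cast_ne_zero.2 k.factorial_ne_zero : (k.factorial : F) ≠ 0)
    rw [← interleavedDet_mul_left]
    have e₁ : (fun j => -(x j ^ (m + (2 * k + 1)))⁻¹ * (1 + -x j ^ (m + (2 * k + 1)))) =
      fun j => (x j ^ (m + (2 * k + 1)) - 1) / x j ^ (m + (2 * k + 1)) := by
      funext j
      ring
    have e₂ : (fun j => -(x j ^ (m + (2 * k + 1)))⁻¹ *
        ((1 - -x j ^ (m + (2 * k + 1))) * ((x j)⁻¹ - x j))) =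
      fun j => -((1 + x j ^ (m + (2 * k + 1))) * ((x j)⁻¹ - x j)) / x j ^ (m + (2 * k + 1)) := by
      funext j
      ring
    rw [e₁, e₂, ← mul_assoc]
    refine h.trans ?_
    simp only [Function.comp_def, id]
    ring
  · have hcard : (-1 : F) ^ (2 * k + 1) = ∏ _j : Fin (2 * k + 1), (-1 : F) := by simp
    rw [hcard, ← Finset.prod_mul_distrib, ← Finset.prod_pow, ← Finset.prod_mul_distrib]
    refine Finset.prod_congr rfl fun j _ => ?_
    rw [neg_mul, neg_one_mul, neg_inj, inv_mul_eq_iff_eq_mul₀ (pow_ne_zero _ (hx j)), ← pow_mul,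
      ← pow_add]
    congr 1
    omega

/-- Both sides of the rectangular decomposition have proportional numerators, with a constant
that does not depend on `m`; the case `m = 0` identifies it as the ratio of denominators. -/
lemma rectNum_div_eq_sum {n : ℕ} (x : Fin n → F) (hx : ∀ j, x j ≠ 0)
    (hx' : ∀ j, x j ≠ (x j)⁻¹) (hu : Function.Injective fun j => x j + (x j)⁻¹)
    {α : ℕ → Type*} (s : ∀ m, Finset (α m)) (μ : ∀ m, α m → Fin n → ℕ) (K : F)
    (hK : ∀ m, ∑ a ∈ s m, spNum x (μ m a) = K * rectNum x m)
    (h0 : ∑ a ∈ s 0, spNum x (μ 0 a) = spNum x fun _ => 0) (m : ℕ) :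
    rectNum x m / rectNum x 0 = ∑ a ∈ s m, spNum x (μ m a) / spNum x fun _ => 0 := by
  have hne := spNum_zero_ne_zero x hx hx' hu
  have h1 := h0.symm.trans (hK 0)
  rw [h1] at hne
  rw [← Finset.sum_div, hK, h1, mul_div_mul_left _ _ (left_ne_zero_of_mul hne)]

lemma schurP_eq_rectNum_div {n : ℕ} (x : Fin n → F) (m : ℕ) :
    schurP (fun j : Fin (2 * n) =>
        if (j : ℕ) % 2 = 0 then x ⟨(j : ℕ) / 2, by have := j.isLt; omega⟩
        else (x ⟨(j : ℕ) / 2, by have := j.isLt; omega⟩)⁻¹)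
      (fun j => if (j : ℕ) < n then (m : ℤ) else 0) = rectNum x m / rectNum x 0 := by
  simp only [schurP, rectNum, Nat.cast_zero, ite_self, zero_add]

lemma spP_eq_spNum_div {n : ℕ} (x : Fin n → F) (μ : Fin n → ℕ) :
    spP x (fun i => (μ i : ℤ)) = spNum x μ / spNum x fun _ => 0 := by
  have h : ∀ (μ : Fin n → ℕ) (i j : Fin n), x j ^ ((μ i : ℤ) + (n : ℤ) - (i : ℕ)) -
      x j ^ (-((μ i : ℤ) + (n : ℤ) - (i : ℕ))) = oddPow (x j) (μ i + n - i) := by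
    intro μ i j
    have e : (μ i : ℤ) + (n : ℤ) - (i : ℕ) = ((μ i + n - i : ℕ) : ℤ) := by omega
    rw [e, _root_.zpow_neg, zpow_natCast, oddPow, inv_pow]
  have h0 := h fun _ => 0
  simp only [Nat.cast_zero, zero_add] at h0
  simp only [spP, spNum, h, h0, zero_add]

lemma gen_ne_zero (n : ℕ) (i : Fin n) : gen n i ≠ 0 := by
  rw [gen, Ne, IsFractionRing.to_map_eq_zero_iff]
  exact MvPolynomial.X_ne_zero i

lemma gen_injective (n : ℕ) : Function.Injective (gen n) :=
  (IsFractionRing.injective _ _).comp (MvPolynomial.X_injective)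

lemma gen_mul_gen_ne_one (n : ℕ) (i j : Fin n) : gen n i * gen n j ≠ 1 := by
  rw [gen, gen, ← map_mul, ← map_one (algebraMap (MvPolynomial (Fin n) ℚ) (FF n))]
  intro h
  have h1 := congrArg (MvPolynomial.eval fun _ => (0 : ℚ)) (IsFractionRing.injective _ _ h)
  simp at h1

lemma gen_add_inv_injective (n : ℕ) : Function.Injective fun i => gen n i + (gen n i)⁻¹ := by
  intro i j h
  have hi := gen_ne_zero n i
  have hj := gen_ne_zero n j
  have h1 : (gen n i - gen n j) * (gen n i * gen n j - 1) = 0 := by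
    simp only at h
    field_simp at h
    linear_combination h
  rcases mul_eq_zero.1 h1 with h2 | h2
  · exact gen_injective n (sub_eq_zero.1 h2)
  · exact absurd (sub_eq_zero.1 h2) (gen_mul_gen_ne_one n i j)

lemma gen_ne_inv (n : ℕ) (i : Fin n) : gen n i ≠ (gen n i)⁻¹ := fun h =>
  gen_mul_gen_ne_one n i i (by
    nth_rewrite 2 [h]
    exact mul_inv_cancel₀ (gen_ne_zero n i))

lemma sum_antitone_fin_one {A : Type*} [AddCommMonoid A] {k : ℕ}
    (f : (Fin k → Fin (0 + 1)) → A) :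
    ∑ ν : Fin k → Fin (0 + 1) with Antitone ν, f ν = f fun _ => 0 := by
  have : Subsingleton (Fin (0 + 1)) := inferInstanceAs (Subsingleton (Fin 1))
  rw [Finset.filter_true_of_mem fun ν _ i j _ => (Subsingleton.elim (ν j) (ν i)).le]
  exact Fintype.sum_subsingleton f _

/-- **Corollary.**  For `n ≥ 1` and a positive integer `m`, the Schur function of rectangular
shape `(m^n)` in the `2n` variables `(x_1, x_1^{-1}, …, x_n, x_n^{-1})` equals the sum of the
symplectic characters `sp_λ(x_1,…,x_n)` over all partitions `λ ⊆ (m^n)` all of whose column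
lengths are even if `n` is even, and over all those all of whose column lengths are odd if `n`
is odd; an identity in `ℚ(x_1, …, x_n)`.  Here `gen n i` plays the role of `x_i`, and the
column length `λ′_c` is the number of indices `j` with `λ_j ≥ c`. -/
theorem schur_rectangle_eq_sum_sp_columns (n m : ℕ) (hn : 1 ≤ n) (hm : 0 < m) :
    schurP
      (fun j : Fin (2 * n) =>
        if (j : ℕ) % 2 = 0 then gen n ⟨(j : ℕ) / 2, by have := j.isLt; omega⟩
        else (gen n ⟨(j : ℕ) / 2, by have := j.isLt; omega⟩)⁻¹)
      (fun j => if (j : ℕ) < n then (m : ℤ) else 0) =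
    if Even n then
      ∑ lam ∈ Finset.univ.filter
          (fun lam : Fin n → Fin (m + 1) =>
            (Antitone fun i => (lam i : ℕ)) ∧
            ∀ c : ℕ, 1 ≤ c → c ≤ m →
              Even (Finset.univ.filter (fun j : Fin n => c ≤ (lam j : ℕ))).card),
        spP (gen n) (fun i => ((lam i : ℕ) : ℤ))
    else
      ∑ lam ∈ Finset.univ.filter
          (fun lam : Fin n → Fin (m + 1) =>
            (Antitone fun i => (lam i : ℕ)) ∧
            ∀ c : ℕ, 1 ≤ c → c ≤ m →
              Odd (Finset.univ.filter (fun j : Fin n => c ≤ (lam j : ℕ))).card),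
        spP (gen n) (fun i => ((lam i : ℕ) : ℤ)) := by
  rw [schurP_eq_rectNum_div]
  simp only [fun lam : Fin n → Fin (m + 1) => spP_eq_spNum_div (gen n) fun i => (lam i : ℕ)]
  split_ifs with hpar
  · obtain ⟨k, rfl⟩ := even_iff_exists_two_mul.1 hpar
    obtain ⟨K, hK⟩ := exists_sum_spNum_even_eq (by omega) (gen (2 * k)) (gen_ne_zero _)
      (gen_add_inv_injective _)
    rw [sum_even_columns fun lam => spNum (gen (2 * k)) (fun i => (lam i : ℕ)) /
      spNum (gen (2 * k)) fun _ => 0]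
    refine rectNum_div_eq_sum (gen (2 * k)) (gen_ne_zero _) (gen_ne_inv _)
      (gen_add_inv_injective _) (α := fun m => Fin k → Fin (m + 1)) _
      (fun _ ν i => (ν ⟨i / 2, by omega⟩ : ℕ)) K hK ?_ m
    refine (sum_antitone_fin_one _).trans (congrArg _ (funext fun i => ?_))
    exact Nat.lt_one_iff.1 (Fin.is_lt _)
  · obtain ⟨k, rfl⟩ := Nat.not_even_iff_odd.1 hpar
    obtain ⟨K, hK⟩ := exists_sum_spNum_odd_eq (gen (2 * k + 1)) (gen_ne_zero _)
      (gen_add_inv_injective _)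
    rw [sum_odd_columns fun lam => spNum (gen (2 * k + 1)) (fun i => (lam i : ℕ)) /
      spNum (gen (2 * k + 1)) fun _ => 0]
    refine rectNum_div_eq_sum (gen (2 * k + 1)) (gen_ne_zero _) (gen_ne_inv _)
      (gen_add_inv_injective _) (α := fun m => Fin k → Fin (m + 1)) _
      (fun m ν i => ((Fin.cons (Fin.last m) fun i : Fin (2 * k) => ν ⟨i / 2, by omega⟩ :
        Fin (2 * k + 1) → Fin (m + 1)) i : ℕ)) K hK ?_ m
    refine (sum_antitone_fin_one _).trans (congrArg _ (funext fun i => ?_))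
    exact Nat.lt_one_iff.1 (Fin.is_lt _)
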